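/- arXiv:2105.04864 — 12 statements merged into one kernel-verified Lean document; each statement's English description precedes it below -/
import Mathlib

section
/- The function px(n, P) is super-additive in n: for every subset P ⊆ ℝ² and all reals m, n > 0, px(m + n, P) ≥ px(m, P) + px(n, P). -/
open MeasureTheory Set
open scoped ENNReal

/-- `S` contains `P` (for subsets of `ℝ²`). -/
def PContains (S P : Set (ℝ × ℝ)) : Prop :=
  ∃ fX fY : ℝ → ℝ,
    (∀ x₀ x₁ : ℝ, (∃ y, (x₀, y) ∈ P) → (∃ y, (x₁, y) ∈ P) → x₁ < x₀ →
      x₀ - x₁ ≤ fX x₀ - fX x₁) ∧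
    (∀ y₀ y₁ : ℝ, (∃ x, (x, y₀) ∈ P) → (∃ x, (x, y₁) ∈ P) → y₁ < y₀ →
      y₀ - y₁ ≤ fY y₀ - fY y₁) ∧
    (∀ p ∈ P, (fX p.1, fY p.2) ∈ S)

/-- `px n P`: supremum of the planar Lebesgue measure of open `P`-free subsets of `[0,n]²`. -/
noncomputable def px (n : ℝ) (P : Set (ℝ × ℝ)) : ℝ≥0∞ :=
  sSup {m : ℝ≥0∞ | ∃ S : Set (ℝ × ℝ), IsOpen S ∧ S ⊆ Set.Icc (0, 0) (n, n) ∧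
    ¬ PContains S P ∧ m = volume S}

theorem PContains.of_preimage_add {S P : Set (ℝ × ℝ)} {v : ℝ × ℝ}
    (h : PContains ((fun p => p + v) ⁻¹' S) P) : PContains S P := by
  obtain ⟨fX, fY, hX, hY, hS⟩ := h
  refine ⟨fun x => fX x + v.1, fun y => fY y + v.2, ?_, ?_, fun p hp => hS p hp⟩
  · intro x₀ x₁ h₀ h₁ h
    linarith [hX x₀ x₁ h₀ h₁ h]
  · intro y₀ y₁ h₀ h₁ h
    linarith [hY y₀ y₁ h₀ h₁ h]

/-- If `P` embeds in a union of two `P`-free sets, the second strictly to the right of the first,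
then `P` splits into two nonempty parts, the second strictly to the right of the first.
The vertical order of the two parts is that of the two sets. -/
theorem PContains.exists_split_of_union {A B P : Set (ℝ × ℝ)} (h : PContains (A ∪ B) P)
    (hA : ¬ PContains A P) (hB : ¬ PContains B P) (hx : ∀ a ∈ A, ∀ b ∈ B, a.1 < b.1) :
    ∃ Q : Set (ℝ × ℝ), (∃ p ∈ P, p ∈ Q) ∧ (∃ q ∈ P, q ∉ Q) ∧
      (∀ p ∈ P, p ∈ Q → ∀ q ∈ P, q ∉ Q → p.1 < q.1) ∧
      ((∀ a ∈ A, ∀ b ∈ B, a.2 < b.2) → ∀ p ∈ P, p ∈ Q → ∀ q ∈ P, q ∉ Q → p.2 < q.2) ∧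
      ((∀ a ∈ A, ∀ b ∈ B, b.2 < a.2) → ∀ p ∈ P, p ∈ Q → ∀ q ∈ P, q ∉ Q → q.2 < p.2) := by
  obtain ⟨fX, fY, hX, hY, hS⟩ := h
  have monoX : ∀ p ∈ P, ∀ q ∈ P, fX p.1 < fX q.1 → p.1 < q.1 := by
    intro p hp q hq hlt
    by_contra! hle
    rcases hle.eq_or_lt with heq | hgt
    · rw [heq] at hlt; exact lt_irrefl _ hlt
    · linarith [hX p.1 q.1 ⟨p.2, hp⟩ ⟨q.2, hq⟩ hgt]
  have monoY : ∀ p ∈ P, ∀ q ∈ P, fY p.2 < fY q.2 → p.2 < q.2 := by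
    intro p hp q hq hlt
    by_contra! hle
    rcases hle.eq_or_lt with heq | hgt
    · rw [heq] at hlt; exact lt_irrefl _ hlt
    · linarith [hY p.2 q.2 ⟨p.1, hp⟩ ⟨q.1, hq⟩ hgt]
  have memB : ∀ q ∈ P, (fX q.1, fY q.2) ∉ A → (fX q.1, fY q.2) ∈ B :=
    fun q hq hqA => (hS q hq).resolve_left hqA
  refine ⟨{p | (fX p.1, fY p.2) ∈ A}, ?_, ?_, ?_, ?_, ?_⟩
  · by_contra! hne
    exact hB ⟨fX, fY, hX, hY, fun p hp => memB p hp (hne p hp)⟩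
  · by_contra! hne
    exact hA ⟨fX, fY, hX, hY, hne⟩
  · exact fun p hp hpA q hq hqA => monoX p hp q hq (hx _ hpA _ (memB q hq hqA))
  · exact fun hy p hp hpA q hq hqA => monoY p hp q hq (hy _ hpA _ (memB q hq hqA))
  · exact fun hy p hp hpA q hq hqA => monoY q hq p hp (hy _ hpA _ (memB q hq hqA))

/-- A set cannot split both along an ascending and along a descending diagonal. -/
theorem not_pContains_union_or {A B A' B' P : Set (ℝ × ℝ)}
    (hA : ¬ PContains A P) (hB : ¬ PContains B P)
    (hA' : ¬ PContains A' P) (hB' : ¬ PContains B' P)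
    (hx : ∀ a ∈ A, ∀ b ∈ B, a.1 < b.1) (hy : ∀ a ∈ A, ∀ b ∈ B, a.2 < b.2)
    (hx' : ∀ a ∈ A', ∀ b ∈ B', a.1 < b.1) (hy' : ∀ a ∈ A', ∀ b ∈ B', b.2 < a.2) :
    ¬ PContains (A ∪ B) P ∨ ¬ PContains (A' ∪ B') P := by
  by_contra! h
  obtain ⟨Q, ⟨p, hp, hpQ⟩, ⟨q, hq, hqQ⟩, hQx, hQy, -⟩ := h.1.exists_split_of_union hA hB hx
  obtain ⟨R, ⟨r, hr, hrR⟩, ⟨s, hs, hsR⟩, hRx, -, hRy⟩ := h.2.exists_split_of_union hA' hB' hx'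
  replace hQy := hQy hy
  replace hRy := hRy hy'
  have key : ∀ a ∈ P, a ∈ Q → ∀ b ∈ P, b ∉ Q → (a ∈ R ↔ b ∈ R) := by
    intro a ha haQ b hb hbQ
    have h₁ := hQx a ha haQ b hb hbQ
    have h₂ := hQy a ha haQ b hb hbQ
    refine ⟨fun haR => ?_, fun hbR => ?_⟩
    · by_contra hbR
      exact lt_asymm h₂ (hRy a ha haR b hb hbR)
    · by_contra haR
      exact lt_asymm h₁ (hRx b hb hbR a ha haR)
  have all : ∀ a ∈ P, (a ∈ R ↔ p ∈ R) := by
    intro a ha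
    by_cases haQ : a ∈ Q
    · exact (key a ha haQ q hq hqQ).trans (key p hp hpQ q hq hqQ).symm
    · exact (key p hp hpQ a ha haQ).symm
  exact hsR ((all s hs).2 ((all r hr).1 hrR))

theorem IsOpen.subset_Ioo_prod_of_subset_Icc {S : Set (ℝ × ℝ)} {a b : ℝ × ℝ} (hS : IsOpen S)
    (h : S ⊆ Icc a b) : S ⊆ Ioo a.1 b.1 ×ˢ Ioo a.2 b.2 := by
  have h' := hS.subset_interior_iff.2 h
  rwa [← Prod.mk.eta (p := a), ← Prod.mk.eta (p := b), Icc_prod_eq, interior_prod_eq,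
    interior_Icc, interior_Icc] at h'

theorem volume_le_px {S P : Set (ℝ × ℝ)} {n : ℝ} (hS : IsOpen S) (h : S ⊆ Icc (0, 0) (n, n))
    (hP : ¬ PContains S P) : volume S ≤ px n P :=
  le_sSup ⟨S, hS, h, hP, rfl⟩

theorem volume_add_le_px {S T P : Set (ℝ × ℝ)} {n : ℝ} {v w : ℝ × ℝ}
    (hS : IsOpen S) (hT : IsOpen T)
    (hx : ∀ a ∈ (fun p => p + v) ⁻¹' S, ∀ b ∈ (fun p => p + w) ⁻¹' T, a.1 < b.1)
    (hSn : (fun p => p + v) ⁻¹' S ⊆ Icc (0, 0) (n, n))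
    (hTn : (fun p => p + w) ⁻¹' T ⊆ Icc (0, 0) (n, n))
    (hP : ¬ PContains ((fun p => p + v) ⁻¹' S ∪ (fun p => p + w) ⁻¹' T) P) :
    volume S + volume T ≤ px n P := by
  have hS' : IsOpen ((fun p => p + v) ⁻¹' S) := hS.preimage (by fun_prop)
  have hT' : IsOpen ((fun p => p + w) ⁻¹' T) := hT.preimage (by fun_prop)
  have hdisj : Disjoint ((fun p => p + v) ⁻¹' S) ((fun p => p + w) ⁻¹' T) :=
    Set.disjoint_left.2 fun a ha hb => lt_irrefl _ (hx a ha a hb)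
  have hle := volume_le_px (hS'.union hT') (union_subset hSn hTn) hP
  rwa [measure_union hdisj hT'.measurableSet, measure_preimage_add_right,
    measure_preimage_add_right] at hle

theorem volume_add_volume_le_px_add {S T P : Set (ℝ × ℝ)} {m n : ℝ} (hm : 0 < m) (hn : 0 < n)
    (hS : IsOpen S) (hT : IsOpen T) (hSm : S ⊆ Icc (0, 0) (m, m)) (hTn : T ⊆ Icc (0, 0) (n, n))
    (hSP : ¬ PContains S P) (hTP : ¬ PContains T P) :
    volume S + volume T ≤ px (m + n) P := by
  have hSb : ∀ p ∈ S, (0 < p.1 ∧ p.1 < m) ∧ 0 < p.2 ∧ p.2 < m :=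
    fun p hp => hS.subset_Ioo_prod_of_subset_Icc hSm hp
  have hTb : ∀ p ∈ T, (0 < p.1 ∧ p.1 < n) ∧ 0 < p.2 ∧ p.2 < n :=
    fun p hp => hT.subset_Ioo_prod_of_subset_Icc hTn hp
  have hSP' (v : ℝ × ℝ) : ¬ PContains ((fun p => p + v) ⁻¹' S) P := fun h => hSP h.of_preimage_add
  have hTP' (v : ℝ × ℝ) : ¬ PContains ((fun p => p + v) ⁻¹' T) P := fun h => hTP h.of_preimage_add
  have hx : ∀ a ∈ (fun p => p + ((0 : ℝ), (0 : ℝ))) ⁻¹' S,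
      ∀ b ∈ (fun p => p + (-m, -m)) ⁻¹' T, a.1 < b.1 := by
    intro a ha b hb
    have h₁ := hSb _ ha
    have h₂ := hTb _ hb
    simp only [Prod.fst_add, Prod.snd_add] at h₁ h₂
    linarith
  have hy : ∀ a ∈ (fun p => p + ((0 : ℝ), (0 : ℝ))) ⁻¹' S,
      ∀ b ∈ (fun p => p + (-m, -m)) ⁻¹' T, a.2 < b.2 := by
    intro a ha b hb
    have h₁ := hSb _ ha
    have h₂ := hTb _ hb
    simp only [Prod.fst_add, Prod.snd_add] at h₁ h₂
    linarith
  have hx' : ∀ a ∈ (fun p => p + ((0 : ℝ), -n)) ⁻¹' S,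
      ∀ b ∈ (fun p => p + (-m, (0 : ℝ))) ⁻¹' T, a.1 < b.1 := by
    intro a ha b hb
    have h₁ := hSb _ ha
    have h₂ := hTb _ hb
    simp only [Prod.fst_add, Prod.snd_add] at h₁ h₂
    linarith
  have hy' : ∀ a ∈ (fun p => p + ((0 : ℝ), -n)) ⁻¹' S,
      ∀ b ∈ (fun p => p + (-m, (0 : ℝ))) ⁻¹' T, b.2 < a.2 := by
    intro a ha b hb
    have h₁ := hSb _ ha
    have h₂ := hTb _ hb
    simp only [Prod.fst_add, Prod.snd_add] at h₁ h₂
    linarith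
  rcases not_pContains_union_or (hSP' _) (hTP' _) (hSP' _) (hTP' _) hx hy hx' hy' with h | h
  · refine volume_add_le_px hS hT hx (fun p hp => ?_) (fun p hp => ?_) h
    · have := hSb _ hp
      simp only [Prod.fst_add, Prod.snd_add] at this
      exact ⟨⟨by linarith, by linarith⟩, by constructor <;> simp only <;> linarith⟩
    · have := hTb _ hp
      simp only [Prod.fst_add, Prod.snd_add] at this
      exact ⟨⟨by linarith, by linarith⟩, by constructor <;> simp only <;> linarith⟩
  · refine volume_add_le_px hS hT hx' (fun p hp => ?_) (fun p hp => ?_) h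
    · have := hSb _ hp
      simp only [Prod.fst_add, Prod.snd_add] at this
      exact ⟨⟨by linarith, by linarith⟩, by constructor <;> simp only <;> linarith⟩
    · have := hTb _ hp
      simp only [Prod.fst_add, Prod.snd_add] at this
      exact ⟨⟨by linarith, by linarith⟩, by constructor <;> simp only <;> linarith⟩

theorem px_empty (n : ℝ) : px n ∅ = 0 := by
  refine sSup_eq_bot.2 ?_
  rintro _ ⟨S, -, -, hS, rfl⟩
  exact absurd ⟨id, id, by simp, by simp, by simp⟩ hS

theorem not_pContains_empty {P : Set (ℝ × ℝ)} (hP : P.Nonempty) : ¬ PContains ∅ P := by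
  rintro ⟨fX, fY, -, -, h⟩
  obtain ⟨p, hp⟩ := hP
  exact h p hp

theorem px_superadditive (P : Set (ℝ × ℝ)) (m n : ℝ) (hm : 0 < m) (hn : 0 < n) :
    px m P + px n P ≤ px (m + n) P := by
  rcases P.eq_empty_or_nonempty with rfl | hP
  · simp [px_empty]
  have hne (k : ℝ) : {c : ℝ≥0∞ | ∃ S : Set (ℝ × ℝ), IsOpen S ∧ S ⊆ Icc (0, 0) (k, k) ∧
      ¬ PContains S P ∧ c = volume S}.Nonempty :=
    ⟨_, ∅, isOpen_empty, empty_subset _, not_pContains_empty hP, rfl⟩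
  rw [px, ENNReal.sSup_add (hne m)]
  refine iSup₂_le ?_
  rintro _ ⟨S, hS, hSm, hSP, rfl⟩
  rw [px, ENNReal.add_sSup (hne n)]
  refine iSup₂_le ?_
  rintro _ ⟨T, hT, hTn, hTP, rfl⟩
  exact volume_add_volume_le_px_add hm hn hS hT hSm hTn hSP hTP
end

section
/- For every subset P ⊆ ℝ², every real n > 0, and every real ε with 0 < ε < n, one has px(n, P) ≤ px(n + ε, P) < px(n, P) + 3nε. -/
open MeasureTheory Set
open scoped ENNReal

theorem PContains.mono {S T P : Set (ℝ × ℝ)} (hST : S ⊆ T) (h : PContains S P) :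
    PContains T P := by
  obtain ⟨fX, fY, hX, hY, hP⟩ := h
  exact ⟨fX, fY, hX, hY, fun p hp => hST (hP p hp)⟩

theorem volume_Icc_square {n : ℝ} (hn : 0 ≤ n) :
    volume (Set.Icc ((0, 0) : ℝ × ℝ) (n, n)) = ENNReal.ofReal (n ^ 2) := by
  rw [← Set.Icc_prod_Icc, Measure.volume_eq_prod, Measure.prod_prod, Real.volume_Icc,
    ← ENNReal.ofReal_mul (by linarith)]
  congr 1
  ring

theorem volume_Ioo_prod_Ioo {n : ℝ} (hn : 0 ≤ n) :
    volume (Set.Ioo 0 n ×ˢ Set.Ioo 0 n : Set (ℝ × ℝ)) = ENNReal.ofReal (n ^ 2) := by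
  rw [Measure.volume_eq_prod, Measure.prod_prod, Real.volume_Ioo,
    ← ENNReal.ofReal_mul (by linarith)]
  congr 1
  ring

theorem Ioo_prod_Ioo_subset_Icc {m n : ℝ} (hmn : m ≤ n) :
    (Set.Ioo 0 m ×ˢ Set.Ioo 0 m : Set (ℝ × ℝ)) ⊆ Set.Icc (0, 0) (n, n) := by
  rw [← Set.Icc_prod_Icc]
  have h : Set.Ioo 0 m ⊆ Set.Icc 0 n :=
    Set.Ioo_subset_Icc_self.trans (Set.Icc_subset_Icc_right hmn)
  exact Set.prod_mono h h

theorem px_mono (P : Set (ℝ × ℝ)) {m n : ℝ} (hmn : m ≤ n) : px m P ≤ px n P := by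
  apply sSup_le_sSup
  rintro _ ⟨S, hS, hSm, hSP, rfl⟩
  exact ⟨S, hS, hSm.trans (Set.Icc_subset_Icc_right ⟨hmn, hmn⟩), hSP, rfl⟩

theorem px_le_ofReal_sq (P : Set (ℝ × ℝ)) {n : ℝ} (hn : 0 ≤ n) :
    px n P ≤ ENNReal.ofReal (n ^ 2) := by
  apply sSup_le
  rintro _ ⟨S, -, hSn, -, rfl⟩
  exact (measure_mono hSn).trans_eq (volume_Icc_square hn)

theorem px_le_px_add (P : Set (ℝ × ℝ)) {m n : ℝ} (hm : 0 ≤ m) (hmn : m ≤ n) :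
    px n P ≤ px m P + ENNReal.ofReal (n ^ 2 - m ^ 2) := by
  apply sSup_le
  rintro _ ⟨S, hS, hSn, hSP, rfl⟩
  set U : Set (ℝ × ℝ) := Set.Ioo 0 m ×ˢ Set.Ioo 0 m
  have hU : IsOpen U := isOpen_Ioo.prod isOpen_Ioo
  have hin : volume (S ∩ U) ≤ px m P :=
    le_sSup ⟨S ∩ U, hS.inter hU,
      Set.inter_subset_right.trans (Ioo_prod_Ioo_subset_Icc le_rfl),
      fun h => hSP (h.mono Set.inter_subset_left), rfl⟩
  have hout : volume (S \ U) ≤ ENNReal.ofReal (n ^ 2 - m ^ 2) := by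
    refine (measure_mono (Set.sdiff_subset_sdiff_left hSn)).trans_eq ?_
    have hUvol : volume U = ENNReal.ofReal (m ^ 2) := volume_Ioo_prod_Ioo hm
    rw [measure_sdiff (Ioo_prod_Ioo_subset_Icc hmn) hU.measurableSet.nullMeasurableSet
      (by rw [hUvol]; exact ENNReal.ofReal_ne_top), hUvol, volume_Icc_square (hm.trans hmn),
      ENNReal.ofReal_sub _ (sq_nonneg m)]
  rw [← measure_inter_add_sdiff S hU.measurableSet]
  exact add_le_add hin hout

theorem px_sandwich (P : Set (ℝ × ℝ)) (n ε : ℝ) (hn : 0 < n) (hε : 0 < ε) (hεn : ε < n) :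
    px n P ≤ px (n + ε) P ∧ px (n + ε) P < px n P + ENNReal.ofReal (3 * n * ε) := by
  have hle : n ≤ n + ε := by linarith
  refine ⟨px_mono P hle, (px_le_px_add P hn.le hle).trans_lt ?_⟩
  have hfin : px n P ≠ ⊤ := ne_top_of_le_ne_top ENNReal.ofReal_ne_top (px_le_ofReal_sq P hn.le)
  refine ENNReal.add_lt_add_left hfin ?_
  rw [ENNReal.ofReal_lt_ofReal_iff (by positivity)]
  nlinarith
end

section
/- Let c > 0 and let P = [0, c] × {0} (a closed horizontal segment of length c). If n > 0 and S ⊆ [0, n]² is an open P-free set, then for every y ∈ [0, n] the 1-dimensional Lebesgue measure of the horizontal section {x ∈ ℝ : (x, y) ∈ S} is at most c. -/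
open MeasureTheory Set
open scoped ENNReal

/-- The distribution function of a compact set does not grow faster than the identity. -/
theorem measureReal_inter_Iic_le_add {K : Set ℝ} (hK : IsCompact K) {x z : ℝ} (hxz : x ≤ z) :
    volume.real (K ∩ Iic z) ≤ volume.real (K ∩ Iic x) + (z - x) := by
  have hfin : volume (K ∩ Iic x) ≠ ∞ := measure_ne_top_of_subset inter_subset_left hK.measure_ne_top
  have hsub : K ∩ Iic z ⊆ (K ∩ Iic x) ∪ Ioc x z := by
    rintro w ⟨hwK, hwz⟩
    rcases le_or_gt w x with h | h
    · exact Or.inl ⟨hwK, h⟩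
    · exact Or.inr ⟨h, hwz⟩
  calc volume.real (K ∩ Iic z) ≤ volume.real ((K ∩ Iic x) ∪ Ioc x z) :=
        measureReal_mono hsub (measure_union_ne_top hfin measure_Ioc_lt_top.ne)
    _ ≤ volume.real (K ∩ Iic x) + volume.real (Ioc x z) := measureReal_union_le _ _
    _ = volume.real (K ∩ Iic x) + (z - x) := by rw [Real.volume_real_Ioc_of_le hxz]

theorem measureReal_inter_Iic_mono {K : Set ℝ} (hK : IsCompact K) :
    Monotone fun x => volume.real (K ∩ Iic x) := fun _ _ h =>
  measureReal_mono (inter_subset_inter_right K (Iic_subset_Iic.2 h))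
    (measure_ne_top_of_subset inter_subset_left hK.measure_ne_top)

theorem continuous_measureReal_inter_Iic {K : Set ℝ} (hK : IsCompact K) :
    Continuous fun x => volume.real (K ∩ Iic x) := by
  refine (LipschitzWith.of_le_add fun x z => ?_).continuous
  rcases le_total x z with h | h
  · exact (measureReal_inter_Iic_mono hK h).trans (le_add_of_nonneg_right dist_nonneg)
  · rw [Real.dist_eq, abs_of_nonneg (sub_nonneg.2 h)]
    exact measureReal_inter_Iic_le_add hK h

/-- The distribution function of a nonempty compact set `K` takes each of its values on `K`. -/
theorem exists_mem_measureReal_inter_Iic_eq {K : Set ℝ} (hK : IsCompact K) (hne : K.Nonempty)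
    {t : ℝ} (ht₀ : 0 ≤ t) (ht : t ≤ volume.real K) :
    ∃ x ∈ K, volume.real (K ∩ Iic x) = t := by
  obtain ⟨a, haK, ha⟩ := hK.exists_isLeast hne
  obtain ⟨b, hbK, hb⟩ := hK.exists_isGreatest hne
  have hga : volume.real (K ∩ Iic a) = 0 := by
    have hsub : K ∩ Iic a ⊆ {a} := fun w hw => le_antisymm hw.2 (ha hw.1)
    rw [measureReal_def, measure_mono_null hsub (measure_singleton a), ENNReal.toReal_zero]
  have hgb : K ∩ Iic b = K := inter_eq_left.2 hb
  have hmem : t ∈ Icc (volume.real (K ∩ Iic a)) (volume.real (K ∩ Iic b)) := by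
    rw [hga, hgb]
    exact ⟨ht₀, ht⟩
  obtain ⟨x, hx, hxt⟩ := intermediate_value_Icc (ha hbK)
    (continuous_measureReal_inter_Iic hK).continuousOn hmem
  obtain ⟨m, hm, hmx⟩ := (hK.inter_right isClosed_Iic).exists_isGreatest ⟨a, haK, hx.1⟩
  have hEq : K ∩ Iic m = K ∩ Iic x := Subset.antisymm
    (inter_subset_inter_right K (Iic_subset_Iic.2 hm.2)) fun w hw => ⟨hw.1, hmx hw⟩
  exact ⟨m, hm.1, hEq ▸ hxt⟩

/-- A compact set of measure at least `c` contains an expanding image of `[0, c]`. -/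
theorem exists_expanding_map_into {K : Set ℝ} (hK : IsCompact K) (hne : K.Nonempty)
    {c : ℝ} (hcK : c ≤ volume.real K) :
    ∃ f : ℝ → ℝ, (∀ t ∈ Icc 0 c, f t ∈ K) ∧
      ∀ s ∈ Icc 0 c, ∀ t ∈ Icc 0 c, s < t → t - s ≤ f t - f s := by
  have h : ∀ t : ℝ, ∃ x, t ∈ Icc 0 c → x ∈ K ∧ volume.real (K ∩ Iic x) = t := fun t => by
    by_cases ht : t ∈ Icc 0 c
    · obtain ⟨x, hx⟩ := exists_mem_measureReal_inter_Iic_eq hK hne ht.1 (ht.2.trans hcK)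
      exact ⟨x, fun _ => hx⟩
    · exact ⟨0, fun h => absurd h ht⟩
  choose f hf using h
  refine ⟨f, fun t ht => (hf t ht).1, fun s hs t ht hst => ?_⟩
  have hs' := (hf s hs).2
  have ht' := (hf t ht).2
  rcases le_total (f s) (f t) with h | h
  · have := measureReal_inter_Iic_le_add hK h
    linarith
  · have : volume.real (K ∩ Iic (f t)) ≤ volume.real (K ∩ Iic (f s)) :=
      measureReal_inter_Iic_mono hK h
    linarith

theorem horizontal_sections_le (c n : ℝ) (hc : 0 < c) (hn : 0 < n) (S : Set (ℝ × ℝ))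
    (hSopen : IsOpen S) (hSsub : S ⊆ Set.Icc (0, 0) (n, n))
    (hfree : ¬ PContains S (Set.Icc (0 : ℝ) c ×ˢ ({0} : Set ℝ))) :
    ∀ y ∈ Set.Icc (0 : ℝ) n, volume {x : ℝ | (x, y) ∈ S} ≤ ENNReal.ofReal c := by
  intro y _
  by_contra! hlt
  have hopen : IsOpen {x : ℝ | (x, y) ∈ S} := hSopen.preimage (by fun_prop)
  obtain ⟨K, hKS, hK, hcK⟩ := hopen.exists_lt_isCompact hlt
  have hne : K.Nonempty := nonempty_of_measure_ne_zero (zero_le.trans_lt hcK).ne'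
  have hcK' : c ≤ volume.real K :=
    (ENNReal.ofReal_le_iff_le_toReal hK.measure_ne_top).1 hcK.le
  obtain ⟨f, hfK, hf⟩ := exists_expanding_map_into hK hne hcK'
  refine hfree ⟨f, fun _ => y, ?_, ?_, ?_⟩
  · rintro s t ⟨_, hs, _⟩ ⟨_, ht, _⟩ hts
    exact hf t ht s hs hts
  · rintro s t ⟨_, _, hs⟩ ⟨_, _, ht⟩ hts
    simp only [mem_singleton_iff] at hs ht
    linarith
  · rintro p ⟨hp, _⟩
    exact hKS (hfK p.1 hp)
end

section
/- Let P ⊆ ℝ² have a rightmost column, i.e., there is a point (m, y₀) ∈ P such that x ≤ m for every (x, y) ∈ P. Let c > 0 and let P' = P ∪ ([m, m + c] × {y₀}) be obtained from P by adding a horizontal segment of length c whose left endpoint is (m, y₀). Then px(n, P') ≤ px(n, P) + c·n for every real n > 0. -/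
open MeasureTheory Set
open scoped ENNReal

/-- The cumulative length of a set of reals is `1`-Lipschitz, in one-sided form. -/
lemma volume_real_inter_Iic_le_add (K : Set ℝ) (hK : IsCompact K) {a b : ℝ} (hab : a ≤ b) :
    volume.real (K ∩ Iic b) ≤ volume.real (K ∩ Iic a) + (b - a) := by
  have hsub : K ∩ Iic b ⊆ (K ∩ Iic a) ∪ Ioc a b := by
    rintro x ⟨hxK, hxb⟩
    rcases le_or_gt x a with h | h
    · exact Or.inl ⟨hxK, h⟩
    · exact Or.inr ⟨h, hxb⟩
  have hfin : volume (K ∩ Iic a ∪ Ioc a b) ≠ ∞ :=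
    (measure_union_lt_top ((measure_mono inter_subset_left).trans_lt hK.measure_lt_top)
      measure_Ioc_lt_top).ne
  calc volume.real (K ∩ Iic b) ≤ volume.real (K ∩ Iic a ∪ Ioc a b) := measureReal_mono hsub hfin
    _ ≤ volume.real (K ∩ Iic a) + volume.real (Ioc a b) := measureReal_union_le _ _
    _ = _ := by rw [Real.volume_real_Ioc_of_le hab]

lemma monotone_volume_real_inter_Iic (K : Set ℝ) (hK : IsCompact K) :
    Monotone fun x => volume.real (K ∩ Iic x) := fun _ _ hab =>
  measureReal_mono (inter_subset_inter_right _ (Iic_subset_Iic.2 hab))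
    ((measure_mono inter_subset_left).trans_lt hK.measure_lt_top).ne

lemma continuous_volume_real_inter_Iic (K : Set ℝ) (hK : IsCompact K) :
    Continuous fun x => volume.real (K ∩ Iic x) := by
  refine (LipschitzWith.of_le_add fun x y => ?_).continuous
  rcases le_total x y with h | h
  · exact (monotone_volume_real_inter_Iic K hK h).trans (le_add_of_nonneg_right dist_nonneg)
  · rw [Real.dist_eq, abs_of_nonneg (sub_nonneg.2 h)]
    exact volume_real_inter_Iic_le_add K hK h

/-- Every intermediate value of the cumulative length of a compact set is attained at a point of
the set. -/
lemma exists_mem_volume_real_inter_Iic_eq (K : Set ℝ) (hK : IsCompact K) {t : ℝ} (ht : 0 < t)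
    (htK : t ≤ volume.real K) : ∃ z ∈ K, volume.real (K ∩ Iic z) = t := by
  obtain ⟨a, ha⟩ := hK.bddBelow
  obtain ⟨b, hb⟩ := hK.bddAbove
  have hKa : volume.real (K ∩ Iic (a - 1)) = 0 := by
    have : K ∩ Iic (a - 1) = ∅ := by
      ext x
      simp only [mem_inter_iff, mem_Iic, mem_empty_iff_false, iff_false, not_and, not_le]
      intro hx
      linarith [ha hx]
    simp [this]
  have hKb : K ∩ Iic b = K := inter_eq_left.2 fun x hx => hb hx
  obtain ⟨w, hw⟩ := mem_range_of_exists_le_of_exists_ge (continuous_volume_real_inter_Iic K hK)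
    ⟨a - 1, by simpa only [hKa] using ht.le⟩ ⟨b, by simpa only [hKb] using htK⟩
  have hne : (K ∩ Iic w).Nonempty := by
    rw [nonempty_iff_ne_empty]
    intro h
    simp only [h, measureReal_empty] at hw
    exact ht.ne hw
  obtain ⟨z, hz, hmax⟩ := (hK.inter_right isClosed_Iic).exists_isGreatest hne
  refine ⟨z, hz.1, ?_⟩
  rw [← hw]
  congr 1
  ext x
  exact ⟨fun h => ⟨h.1, le_trans (mem_Iic.1 h.2) hz.2⟩, fun h => ⟨h.1, hmax h⟩⟩

/-- A set of length more than `c` to the right of `u` receives an expanding map from `(0, c]`,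
extended by `0 ↦ u`. -/
lemma exists_expanding_map (U : Set ℝ) (hU : MeasurableSet U) (u c : ℝ)
    (hc : ENNReal.ofReal c < volume (U ∩ Ioi u)) :
    ∃ h : ℝ → ℝ, (∀ t, 0 < t → t ≤ c → h t ∈ U ∧ u + t ≤ h t) ∧
      ∀ s t, 0 < s → s < t → t ≤ c → t - s ≤ h t - h s := by
  obtain ⟨K, hKU, hK, hcK⟩ := (hU.inter measurableSet_Ioi).exists_lt_isCompact hc
  have hcK' : c ≤ volume.real K := (ENNReal.ofReal_le_iff_le_toReal hK.measure_lt_top.ne).1 hcK.le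
  have hex : ∀ t, ∃ z, 0 < t → t ≤ c → z ∈ K ∧ volume.real (K ∩ Iic z) = t := by
    intro t
    by_cases ht : 0 < t ∧ t ≤ c
    · obtain ⟨z, hz⟩ := exists_mem_volume_real_inter_Iic_eq K hK ht.1 (ht.2.trans hcK')
      exact ⟨z, fun _ _ => hz⟩
    · exact ⟨0, fun h₁ h₂ => absurd ⟨h₁, h₂⟩ ht⟩
  choose h hh using hex
  refine ⟨h, fun t ht htc => ?_, fun s t hs hst htc => ?_⟩
  · obtain ⟨hmem, heq⟩ := hh t ht htc
    have hu : volume.real (K ∩ Iic u) = 0 := by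
      have : K ∩ Iic u = ∅ := by
        ext x
        simp only [mem_inter_iff, mem_Iic, mem_empty_iff_false, iff_false, not_and, not_le]
        exact fun hx => (hKU hx).2
      simp [this]
    refine ⟨(hKU hmem).1, ?_⟩
    have := volume_real_inter_Iic_le_add K hK (le_of_lt (hKU hmem).2)
    linarith
  · obtain ⟨-, heqs⟩ := hh s hs (hst.le.trans htc)
    obtain ⟨-, heqt⟩ := hh t (hs.trans hst) htc
    have hle : h s ≤ h t := by
      by_contra! hlt
      have : volume.real (K ∩ Iic (h t)) ≤ volume.real (K ∩ Iic (h s)) :=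
        monotone_volume_real_inter_Iic K hK hlt.le
      linarith
    have := volume_real_inter_Iic_le_add K hK hle
    linarith

/-- The points of `S` having more than length `c` of `S` to their right in the same row. -/
def rightCore (S : Set (ℝ × ℝ)) (c : ℝ) : Set (ℝ × ℝ) :=
  {p ∈ S | ENNReal.ofReal c < volume ({x | (x, p.2) ∈ S} ∩ Ioi p.1)}

lemma isOpen_row {S : Set (ℝ × ℝ)} (hS : IsOpen S) (y : ℝ) : IsOpen {x | (x, y) ∈ S} :=
  hS.preimage (by fun_prop : Continuous fun x : ℝ => (x, y))

lemma isOpen_rightCore {S : Set (ℝ × ℝ)} (hS : IsOpen S) (c : ℝ) : IsOpen (rightCore S c) := by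
  rw [isOpen_iff_mem_nhds]
  rintro p ⟨hpS, hp⟩
  obtain ⟨K, hKU, hK, hcK⟩ :=
    ((isOpen_row hS p.2).inter isOpen_Ioi).measurableSet.exists_lt_isCompact hp
  have hW : IsOpen {z : (ℝ × ℝ) × ℝ | (z.2, z.1.2) ∈ S ∧ z.1.1 < z.2} :=
    (hS.preimage (by fun_prop : Continuous fun z : (ℝ × ℝ) × ℝ => (z.2, z.1.2))).inter
      (isOpen_lt (continuous_fst.comp continuous_fst) continuous_snd)
  have hev : ∀ᶠ q in nhds p, ∀ x ∈ K, (x, q.2) ∈ S ∧ q.1 < x :=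
    hK.eventually_forall_of_forall_eventually fun x hx => hW.mem_nhds (hKU hx)
  filter_upwards [hS.mem_nhds hpS, hev] with q hqS hq
  exact ⟨hqS, hcK.trans_le (measure_mono hq)⟩

/-- If every point of `D ⊆ U` has at most length `c` of `U` to its right, then `D` has length at
most `c`. -/
lemma volume_le_of_volume_inter_Ioi_le {U D : Set ℝ} (hD : MeasurableSet D) (hDU : D ⊆ U)
    {c : ℝ≥0∞} (h : ∀ x ∈ D, volume (U ∩ Ioi x) ≤ c) : volume D ≤ c := by
  rw [hD.measure_eq_iSup_isCompact]
  refine iSup₂_le fun K hKD => iSup_le fun hK => ?_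
  rcases K.eq_empty_or_nonempty with rfl | hne
  · simp
  obtain ⟨x, hx, hmin⟩ := hK.exists_isLeast hne
  have hsub : K ⊆ {x} ∪ (U ∩ Ioi x) := fun z hz => by
    rcases (hmin hz).eq_or_lt with h | h
    · exact Or.inl h.symm
    · exact Or.inr ⟨hDU (hKD hz), h⟩
  calc volume K ≤ volume ({x} : Set ℝ) + volume (U ∩ Ioi x) :=
        (measure_mono hsub).trans (measure_union_le _ _)
    _ ≤ c := by simpa using h x (hKD hx)

lemma volume_diff_rightCore_le {S : Set (ℝ × ℝ)} (hS : IsOpen S) {n c : ℝ} (hc : 0 ≤ c)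
    (hSn : S ⊆ Icc (0, 0) (n, n)) : volume (S \ rightCore S c) ≤ ENNReal.ofReal (c * n) := by
  have hmeas : MeasurableSet (S \ rightCore S c) :=
    hS.measurableSet.diff (isOpen_rightCore hS c).measurableSet
  rw [Measure.volume_eq_prod, Measure.prod_apply_symm hmeas]
  calc ∫⁻ y, volume ((fun x => (x, y)) ⁻¹' (S \ rightCore S c))
      ≤ ∫⁻ y, (Icc (0 : ℝ) n).indicator (fun _ => ENNReal.ofReal c) y := by
        refine lintegral_mono fun y => ?_
        by_cases hy : y ∈ Icc (0 : ℝ) n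
        · rw [indicator_of_mem hy]
          refine volume_le_of_volume_inter_Ioi_le (U := {x | (x, y) ∈ S})
            (hmeas.preimage (by fun_prop)) (fun x hx => hx.1) fun x hx => ?_
          by_contra! hlt
          exact hx.2 ⟨hx.1, hlt⟩
        · have : (fun x => (x, y)) ⁻¹' (S \ rightCore S c) = ∅ := by
            ext x
            simp only [mem_preimage, mem_empty_iff_false, iff_false]
            exact fun hx => hy ⟨(hSn hx.1).1.2, (hSn hx.1).2.2⟩
          simp [this]
    _ = ENNReal.ofReal (c * n) := by
        rw [lintegral_indicator_const measurableSet_Icc, Real.volume_Icc, sub_zero,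
          ENNReal.ofReal_mul hc]

lemma PContains.add_segment {S P : Set (ℝ × ℝ)} (hS : IsOpen S) {m y₀ c : ℝ}
    (hmem : (m, y₀) ∈ P) (hright : ∀ p ∈ P, p.1 ≤ m) (h : PContains (rightCore S c) P) :
    PContains S (P ∪ (Icc m (m + c) ×ˢ ({y₀} : Set ℝ))) := by
  obtain ⟨fX, fY, hX, hY, hP⟩ := h
  obtain ⟨g, hg, hg'⟩ := exists_expanding_map _ (isOpen_row hS (fY y₀)).measurableSet (fX m) c
    (hP _ hmem).2
  have hcol : ∀ x, (∃ y, (x, y) ∈ P ∪ (Icc m (m + c) ×ˢ ({y₀} : Set ℝ))) →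
      (x ≤ m ∧ ∃ y, (x, y) ∈ P) ∨ (m < x ∧ x - m ≤ c) := by
    rintro x ⟨y, hxy | ⟨hx, -⟩⟩
    · exact Or.inl ⟨hright _ hxy, y, hxy⟩
    · rcases hx.1.eq_or_lt with h | h
      · obtain rfl : m = x := h
        exact Or.inl ⟨le_rfl, y₀, hmem⟩
      · exact Or.inr ⟨h, sub_le_iff_le_add'.2 hx.2⟩
  have hrow : ∀ y, (∃ x, (x, y) ∈ P ∪ (Icc m (m + c) ×ˢ ({y₀} : Set ℝ))) → ∃ x, (x, y) ∈ P := by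
    rintro y ⟨x, hxy | ⟨-, hy⟩⟩
    · exact ⟨x, hxy⟩
    · obtain rfl : y = y₀ := hy
      exact ⟨m, hmem⟩
  refine ⟨fun x => if x ≤ m then fX x else g (x - m), fY, fun x₀ x₁ h₀ h₁ hlt => ?_,
    fun y₀ y₁ h₀ h₁ => hY y₀ y₁ (hrow _ h₀) (hrow _ h₁), ?_⟩
  · rcases hcol _ h₀ with ⟨h₀m, h₀⟩ | ⟨h₀m, h₀⟩ <;> rcases hcol _ h₁ with ⟨h₁m, h₁⟩ | ⟨h₁m, h₁⟩
    · simpa only [if_pos h₀m, if_pos h₁m] using hX _ _ h₀ h₁ hlt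
    · linarith
    · simp only [if_neg h₀m.not_ge, if_pos h₁m]
      have hgx := (hg (x₀ - m) (sub_pos.2 h₀m) h₀).2
      rcases h₁m.eq_or_lt with rfl | h₁m
      · linarith
      · linarith [hX m x₁ ⟨y₀, hmem⟩ h₁ h₁m]
    · simp only [if_neg h₀m.not_ge, if_neg h₁m.not_ge]
      linarith [hg' (x₁ - m) (x₀ - m) (sub_pos.2 h₁m) (by linarith) h₀]
  · rintro ⟨x, y⟩ (hxy | ⟨hx, hy⟩)
    · simpa only [if_pos (show x ≤ m from hright _ hxy)] using (hP _ hxy).1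
    · obtain rfl : y = y₀ := hy
      rcases hx.1.eq_or_lt with h | h
      · obtain rfl : m = x := h
        simpa only [if_pos le_rfl] using (hP _ hmem).1
      · have h' : m < x := h
        simp only [if_neg h'.not_ge]
        exact (hg (x - m) (sub_pos.2 h') (sub_le_iff_le_add'.2 hx.2)).1

theorem px_add_segment (P : Set (ℝ × ℝ)) (m y₀ : ℝ) (hmem : (m, y₀) ∈ P)
    (hright : ∀ p ∈ P, p.1 ≤ m) (c : ℝ) (hc : 0 < c) (n : ℝ) (hn : 0 < n) :
    px n (P ∪ (Set.Icc m (m + c) ×ˢ ({y₀} : Set ℝ))) ≤ px n P + ENNReal.ofReal (c * n) := by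
  refine sSup_le ?_
  rintro _ ⟨S, hS, hSn, hfree, rfl⟩
  have hsub : rightCore S c ⊆ S := sep_subset _ _
  calc volume S = volume (rightCore S c ∪ S \ rightCore S c) := by rw [union_sdiff_cancel hsub]
    _ ≤ volume (rightCore S c) + volume (S \ rightCore S c) := measure_union_le _ _
    _ ≤ px n P + ENNReal.ofReal (c * n) :=
      add_le_add
        (le_sSup ⟨_, isOpen_rightCore hS c, hsub.trans hSn,
          fun h => hfree (h.add_segment hS hmem hright), rfl⟩)
        (volume_diff_rightCore_le hS hc.le hSn)
end

section
/- Let P ⊆ ℝ² have a rightmost column, i.e., there is a point (m, y₀) ∈ P such that x ≤ m for every (x, y) ∈ P. Let c > 0 and let P' = P ∪ {(m + c, y₀)} be obtained from P by adding a single new point a distance c to the right of (m, y₀). Then px(n, P') ≤ px(n, P) + c·n for every real n > 0. -/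
open MeasureTheory Set
open scoped ENNReal

/-- The points of `S` that have another point of `S` at distance at least `c` to their right. -/
def rightShiftable (c : ℝ) (S : Set (ℝ × ℝ)) : Set (ℝ × ℝ) :=
  {p | p ∈ S ∧ ∃ t, c ≤ t ∧ (p.1 + t, p.2) ∈ S}

theorem IsOpen.rightShiftable {S : Set (ℝ × ℝ)} (hS : IsOpen S) (c : ℝ) :
    IsOpen (rightShiftable c S) := by
  have h : _root_.rightShiftable c S =
      S ∩ ⋃ t ∈ Set.Ici c, (fun p : ℝ × ℝ => (p.1 + t, p.2)) ⁻¹' S := by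
    ext p
    simp [_root_.rightShiftable]
  rw [h]
  exact hS.inter (isOpen_biUnion fun t _ => hS.preimage (by fun_prop))

theorem PContains.insert_of_rightShiftable {S P : Set (ℝ × ℝ)} {m y₀ c : ℝ}
    (hmem : (m, y₀) ∈ P) (hright : ∀ p ∈ P, p.1 ≤ m) (hc : 0 < c)
    (h : PContains (rightShiftable c S) P) : PContains S (insert (m + c, y₀) P) := by
  obtain ⟨fX, fY, hX, hY, hP⟩ := h
  obtain ⟨-, t, hct, ht⟩ := hP _ hmem
  have hcol : ∀ x, (∃ y, (x, y) ∈ insert (m + c, y₀) P) → x = m + c ∨ ∃ y, (x, y) ∈ P := by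
    rintro x ⟨y, hy | hy⟩
    · exact Or.inl (congrArg Prod.fst hy)
    · exact Or.inr ⟨y, hy⟩
  have hrow : ∀ y, (∃ x, (x, y) ∈ insert (m + c, y₀) P) → ∃ x, (x, y) ∈ P := by
    rintro y ⟨x, hx | hx⟩
    · obtain rfl : y = y₀ := congrArg Prod.snd hx
      exact ⟨m, hmem⟩
    · exact ⟨x, hx⟩
  have hle : ∀ x, (∃ y, (x, y) ∈ P) → x ≤ m := fun x ⟨y, hy⟩ => hright _ hy
  have hne : ∀ x, (∃ y, (x, y) ∈ P) → x ≠ m + c := fun x hx =>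
    ((hle x hx).trans_lt (lt_add_of_pos_right m hc)).ne
  refine ⟨Function.update fX (m + c) (fX m + t), fY, ?_,
    fun y y' hy hy' => hY y y' (hrow y hy) (hrow y' hy'), ?_⟩
  · intro x x' hx hx' hlt
    rcases hcol x hx with rfl | hx <;> rcases hcol x' hx' with rfl | hx'
    · exact absurd hlt (lt_irrefl _)
    · rw [Function.update_self, Function.update_of_ne (hne x' hx')]
      rcases (hle x' hx').eq_or_lt with rfl | hlt'
      · linarith
      · linarith [hX m x' ⟨y₀, hmem⟩ hx' hlt']
    · linarith [hle x hx]
    · rw [Function.update_of_ne (hne x hx), Function.update_of_ne (hne x' hx')]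
      exact hX x x' hx hx' hlt
  · rintro p (rfl | hp)
    · simpa using ht
    · rw [Function.update_of_ne (hne p.1 ⟨p.2, hp⟩)]
      exact (hP p hp).1

theorem volume_diff_rightShiftable_le {S : Set (ℝ × ℝ)} (hS : IsOpen S) {n c : ℝ} (hc : 0 < c)
    (hsub : S ⊆ Set.Icc (0, 0) (n, n)) :
    volume (S \ rightShiftable c S) ≤ ENNReal.ofReal (c * n) := by
  have hmeas : MeasurableSet (S \ rightShiftable c S) :=
    hS.measurableSet.diff (hS.rightShiftable c).measurableSet
  rw [Measure.volume_eq_prod, Measure.prod_apply_symm hmeas]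
  calc ∫⁻ y, volume ((fun x => (x, y)) ⁻¹' (S \ rightShiftable c S))
      ≤ ∫⁻ y, (Set.Icc 0 n).indicator (fun _ => ENNReal.ofReal c) y := by
        refine lintegral_mono fun y => ?_
        by_cases hy : y ∈ Set.Icc 0 n
        · rw [Set.indicator_of_mem hy]
          refine (Real.volume_le_diam _).trans (Metric.ediam_le fun x hx x' hx' => ?_)
          have key : ∀ a b : ℝ, (a, y) ∈ S \ rightShiftable c S → (b, y) ∈ S → b - a ≤ c := by
            intro a b ha hb
            by_contra! hab
            exact ha.2 ⟨ha.1, b - a, hab.le, by simpa using hb⟩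
          rw [edist_dist, Real.dist_eq]
          exact ENNReal.ofReal_le_ofReal
            (abs_sub_le_iff.2 ⟨key x' x hx' hx.1, key x x' hx hx'.1⟩)
        · rw [Set.indicator_of_notMem hy]
          have hempty : (fun x => (x, y)) ⁻¹' (S \ rightShiftable c S) = ∅ :=
            Set.eq_empty_of_forall_notMem fun x hx =>
              hy ⟨(hsub hx.1).1.2, (hsub hx.1).2.2⟩
          rw [hempty, measure_empty]
    _ = ENNReal.ofReal (c * n) := by
        rw [lintegral_indicator_const measurableSet_Icc, Real.volume_Icc, sub_zero,
          ENNReal.ofReal_mul hc.le]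

theorem px_add_point (P : Set (ℝ × ℝ)) (m y₀ : ℝ) (hmem : (m, y₀) ∈ P)
    (hright : ∀ p ∈ P, p.1 ≤ m) (c : ℝ) (hc : 0 < c) (n : ℝ) (hn : 0 < n) :
    px n (insert (m + c, y₀) P) ≤ px n P + ENNReal.ofReal (c * n) := by
  refine sSup_le ?_
  rintro _ ⟨S, hS, hsub, hfree, rfl⟩
  calc volume S
      ≤ volume (S ∩ rightShiftable c S) + volume (S \ rightShiftable c S) :=
        measure_le_inter_add_sdiff _ _ _
    _ ≤ px n P + ENNReal.ofReal (c * n) := by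
        refine add_le_add ?_ (volume_diff_rightShiftable_le hS hc hsub)
        refine (measure_mono Set.inter_subset_right).trans (le_sSup ?_)
        exact ⟨_, hS.rightShiftable c, fun p hp => hsub hp.1,
          fun h => hfree (h.insert_of_rightShiftable hmem hright hc), rfl⟩
end

section
/- For every 0-1 matrix M and all positive integers n and k, ex(n, S(M, k)) ≤ (k+1)² · ex(⌈n/(k+1)⌉, M). -/
open Set

/-- A 0-1 matrix `A` contains a 0-1 matrix `M`. -/
def MContains {n₁ n₂ a b : ℕ} (A : Fin n₁ → Fin n₂ → Prop) (M : Fin a → Fin b → Prop) : Prop :=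
  ∃ r : Fin a → Fin n₁, ∃ c : Fin b → Fin n₂, StrictMono r ∧ StrictMono c ∧
    ∀ i j, M i j → A (r i) (c j)

/-- `mEx n M`: the maximum number of ones in an `n × n` 0-1 matrix avoiding `M`. -/
noncomputable def mEx (n : ℕ) {a b : ℕ} (M : Fin a → Fin b → Prop) : ℕ :=
  sSup {k : ℕ | ∃ A : Fin n → Fin n → Prop, ¬ MContains A M ∧
    k = {p : Fin n × Fin n | A p.1 p.2}.ncard}

/-- `blowup M k` is `S(M, k)`: the matrix `M` with `k` rows of zeroes inserted between
consecutive rows and `k` columns of zeroes inserted between consecutive columns. -/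
def blowup {a b : ℕ} (M : Fin a → Fin b → Prop) (k : ℕ) :
    Fin ((k + 1) * (a - 1) + 1) → Fin ((k + 1) * (b - 1) + 1) → Prop :=
  fun i j => ∃ (i' : Fin a) (j' : Fin b), M i' j' ∧
    (i : ℕ) = (k + 1) * (i' : ℕ) ∧ (j : ℕ) = (k + 1) * (j' : ℕ)

theorem ncard_le_mEx {n a b : ℕ} {M : Fin a → Fin b → Prop} {A : Fin n → Fin n → Prop}
    (hA : ¬ MContains A M) : {p : Fin n × Fin n | A p.1 p.2}.ncard ≤ mEx n M := by
  refine le_csSup ⟨n * n, ?_⟩ ⟨A, hA, rfl⟩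
  rintro _ ⟨B, -, rfl⟩
  simpa using Set.ncard_le_card {p : Fin n × Fin n | B p.1 p.2}

theorem mEx_le {n a b c : ℕ} {M : Fin a → Fin b → Prop}
    (h : ∀ A : Fin n → Fin n → Prop, ¬ MContains A M →
      {p : Fin n × Fin n | A p.1 p.2}.ncard ≤ c) : mEx n M ≤ c := by
  refine csSup_le' ?_
  rintro _ ⟨A, hA, rfl⟩
  exact h A hA

theorem val_add_le_of_strictMono {a N : ℕ} {r : Fin a → Fin N} (hr : StrictMono r)
    {i j : Fin a} (hij : i ≤ j) : (r i : ℕ) + (j - i) ≤ r j := by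
  obtain ⟨j, hj⟩ := j
  induction j with
  | zero =>
    have : i = ⟨0, hj⟩ := le_antisymm hij (Nat.zero_le _)
    simp [this]
  | succ j ih =>
    rcases hij.lt_or_eq with h | rfl
    · have hij' : (i : ℕ) ≤ j := Nat.lt_succ_iff.mp h
      have h₁ := ih (by omega) hij'
      have h₂ : r ⟨j, by omega⟩ < r ⟨j + 1, hj⟩ := hr (Nat.lt_succ_self j)
      rw [Fin.lt_def] at h₂
      dsimp only at h₁ ⊢
      omega
    · simp

/-- `Fin n` embeds in `Fin N` with the gap placed so that a strictly monotone map into `Fin N`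
taking `i₀` outside the gap can be pulled back without changing it up to `i₀`. -/
theorem exists_injective_pullback {n N a : ℕ} (hN : n ≤ N) (i₀ : Fin a) :
    ∃ f : Fin n → Fin N, Function.Injective f ∧
      ∀ r : Fin a → Fin N, StrictMono r → r i₀ ∈ range f →
        ∃ R : Fin a → Fin n, StrictMono R ∧ ∀ i ≤ i₀, f (R i) = r i := by
  have hi₀ := i₀.isLt
  refine ⟨fun i => if h : (i : ℕ) < n - (a - 1 - i₀) then ⟨i, by omega⟩ else
    ⟨i + (N - n), by omega⟩, ?_, ?_⟩
  · intro i j hij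
    ext
    dsimp only at hij
    split_ifs at hij <;> simp only [Fin.mk.injEq] at hij <;> omega
  · rintro r hr ⟨x, hx⟩
    have hlast := val_add_le_of_strictMono hr (i := i₀) (j := ⟨a - 1, by omega⟩)
      (by rw [Fin.le_def]; dsimp only; omega)
    have hrlast := (r ⟨a - 1, by omega⟩).isLt
    have hlt : (r i₀ : ℕ) < n - (a - 1 - i₀) := by
      have hxlt := x.isLt
      have hx' := congrArg Fin.val hx
      dsimp only at hx' hlast
      split_ifs at hx' <;> dsimp only at hx' <;> omega
    have hle : (i₀ : ℕ) ≤ r i₀ := by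
      have := val_add_le_of_strictMono hr (i := ⟨0, by omega⟩) (j := i₀) (Nat.zero_le _)
      dsimp only at this
      omega
    have hmono : ∀ i ≤ i₀, (r i : ℕ) ≤ r i₀ := fun i hi => hr.monotone hi
    refine ⟨fun i => if h : i ≤ i₀ then ⟨r i, by have := hmono i h; omega⟩ else
      ⟨n + i - a, by have := i.isLt; omega⟩, ?_, ?_⟩
    · intro i j hij
      have hrij : (r i : ℕ) < r j := hr hij
      have hij' : (i : ℕ) < j := hij
      have hi := hmono i
      dsimp only
      split_ifs with h₁ h₂ h₂ <;> simp only [Fin.lt_def, Fin.le_def] at * <;> omega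
    · intro i hi
      have := hmono i hi
      simp only [hi, dif_pos]
      rw [dif_pos (by omega)]

theorem mEx_mono {n N a b : ℕ} (hN : n ≤ N) {M : Fin a → Fin b → Prop} (hM : ∃ i j, M i j) :
    mEx n M ≤ mEx N M := by
  classical
  obtain ⟨i₁, j₁, h₁⟩ := hM
  obtain ⟨i₀, ⟨j', hi₀⟩, hi₀max⟩ :=
    (Set.toFinite {i | ∃ j, M i j}).exists_maximalFor id _ ⟨i₁, j₁, h₁⟩
  obtain ⟨j₀, ⟨i', hj₀⟩, hj₀max⟩ :=
    (Set.toFinite {j | ∃ i, M i j}).exists_maximalFor id _ ⟨j₁, i₁, h₁⟩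
  have hrow : ∀ i j, M i j → i ≤ i₀ := fun i j h =>
    (le_total i i₀).elim id fun h' => hi₀max ⟨j, h⟩ h'
  have hcol : ∀ i j, M i j → j ≤ j₀ := fun i j h =>
    (le_total j j₀).elim id fun h' => hj₀max ⟨i, h⟩ h'
  obtain ⟨f, hf, hf'⟩ := exists_injective_pullback hN i₀
  obtain ⟨g, hg, hg'⟩ := exists_injective_pullback hN j₀
  refine mEx_le fun A hA => ?_
  let B : Fin N → Fin N → Prop := fun x y => ∃ i j, f i = x ∧ g j = y ∧ A i j
  have hB : ¬ MContains B M := by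
    rintro ⟨r, c, hr, hc, h⟩
    obtain ⟨x, -, hx, -, -⟩ := h _ _ hi₀
    obtain ⟨-, y, -, hy, -⟩ := h _ _ hj₀
    obtain ⟨R, hR, hfR⟩ := hf' r hr ⟨x, hx⟩
    obtain ⟨C, hC, hgC⟩ := hg' c hc ⟨y, hy⟩
    refine hA ⟨R, C, hR, hC, fun i j hij => ?_⟩
    obtain ⟨u, v, hu, hv, huv⟩ := h i j hij
    rw [← hfR i (hrow i j hij)] at hu
    rw [← hgC j (hcol i j hij)] at hv
    rwa [← hf hu, ← hg hv]
  refine le_trans ?_ (ncard_le_mEx hB)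
  exact Set.ncard_le_ncard_of_injOn (Prod.map f g) (fun p hp => ⟨p.1, p.2, rfl, rfl, hp⟩)
    (hf.prodMap hg).injOn

/-- A strictly monotone map into `Fin m` spreads out to one into `Fin (m * (k + 1))`, with the
images of the multiples of `k + 1` in the residue class of `s`. -/
theorem exists_strictMono_spread {a m k : ℕ} {r : Fin a → Fin m} (hr : StrictMono r) (ha : 0 < a)
    (s : Fin (k + 1)) :
    ∃ R : Fin ((k + 1) * (a - 1) + 1) → Fin (m * (k + 1)), StrictMono R ∧
      ∀ (p : Fin ((k + 1) * (a - 1) + 1)) (i : Fin a), (p : ℕ) = (k + 1) * i →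
        R p = finProdFinEquiv (r i, s) := by
  have hs := s.isLt
  have hdiv : ∀ p : Fin ((k + 1) * (a - 1) + 1), (p : ℕ) / (k + 1) < a := fun p => by
    have : (p : ℕ) / (k + 1) ≤ a - 1 := Nat.div_le_of_le_mul (Nat.lt_succ_iff.mp p.isLt)
    omega
  have hbound : ∀ p : Fin ((k + 1) * (a - 1) + 1),
      s + (k + 1) * (r ⟨p / (k + 1), hdiv p⟩ : ℕ) + p % (k + 1) < m * (k + 1) := fun p => by
    have hmod := Nat.mod_lt (p : ℕ) (Nat.succ_pos k)
    have hdm := Nat.div_add_mod (p : ℕ) (k + 1)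
    have hp := p.isLt
    have hrp := (r ⟨p / (k + 1), hdiv p⟩).isLt
    by_cases hq : (p : ℕ) / (k + 1) < a - 1
    · have h₁ : r ⟨p / (k + 1), hdiv p⟩ < r ⟨a - 1, by omega⟩ := hr hq
      have h₂ := (r ⟨a - 1, by omega⟩).isLt
      rw [Fin.lt_def] at h₁
      have h₃ : (r ⟨p / (k + 1), hdiv p⟩ : ℕ) + 2 ≤ m := by omega
      have := Nat.mul_le_mul_left (k + 1) h₃
      rw [mul_add] at this
      rw [mul_comm m]
      simp only [Nat.succ_eq_add_one] at hmod
      omega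
    · have h₁ : (p : ℕ) / (k + 1) = a - 1 := by have := hdiv p; omega
      rw [h₁] at hdm
      have h₃ : (r ⟨p / (k + 1), hdiv p⟩ : ℕ) + 1 ≤ m := by omega
      have := Nat.mul_le_mul_left (k + 1) h₃
      rw [mul_add] at this
      rw [mul_comm m]
      omega
  refine ⟨fun p => ⟨_, hbound p⟩, ?_, ?_⟩
  · intro p q hpq
    have hpq' : (p : ℕ) < q := hpq
    have hp := Nat.div_add_mod (p : ℕ) (k + 1)
    have hq := Nat.div_add_mod (q : ℕ) (k + 1)
    have hmod := Nat.mod_lt (p : ℕ) (Nat.succ_pos k)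
    simp only [Nat.succ_eq_add_one] at hmod
    rw [Fin.lt_def]
    dsimp only
    rcases (Nat.div_le_div_right (c := k + 1) hpq'.le).lt_or_eq with h | h
    · have h₁ : r ⟨p / (k + 1), hdiv p⟩ < r ⟨q / (k + 1), hdiv q⟩ := hr h
      have h₂ : (r ⟨p / (k + 1), hdiv p⟩ : ℕ) + 1 ≤ r ⟨q / (k + 1), hdiv q⟩ := h₁
      have := Nat.mul_le_mul_left (k + 1) h₂
      rw [mul_add] at this
      omega
    · simp only [h] at hp ⊢
      omega
  · intro p i hp
    ext
    simp [hp]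

theorem mEx_mul_blowup {a b : ℕ} {M : Fin a → Fin b → Prop} (m k : ℕ) (ha : 0 < a) (hb : 0 < b) :
    mEx (m * (k + 1)) (blowup M k) ≤ (k + 1) ^ 2 * mEx m M := by
  classical
  refine mEx_le fun A hA => ?_
  let B : Fin (k + 1) × Fin (k + 1) → Fin m → Fin m → Prop := fun s i j =>
    A (finProdFinEquiv (i, s.1)) (finProdFinEquiv (j, s.2))
  have hB : ∀ s, ¬ MContains (B s) M := by
    rintro s ⟨r, c, hr, hc, h⟩
    obtain ⟨R, hR, hR'⟩ := exists_strictMono_spread hr ha s.1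
    obtain ⟨C, hC, hC'⟩ := exists_strictMono_spread hc hb s.2
    refine hA ⟨R, C, hR, hC, ?_⟩
    rintro p q ⟨i, j, hij, hp, hq⟩
    rw [hR' p i hp, hC' q j hq]
    exact h i j hij
  have hcover : {p : Fin (m * (k + 1)) × Fin (m * (k + 1)) | A p.1 p.2} ⊆
      ⋃ s ∈ (Finset.univ : Finset (Fin (k + 1) × Fin (k + 1))),
        (fun p : Fin m × Fin m => (finProdFinEquiv (p.1, s.1), finProdFinEquiv (p.2, s.2))) ''
          {p | B s p.1 p.2} := by
    rintro ⟨x, y⟩ hxy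
    obtain ⟨⟨i, s⟩, rfl⟩ := finProdFinEquiv.surjective x
    obtain ⟨⟨j, t⟩, rfl⟩ := finProdFinEquiv.surjective y
    simp only [mem_iUnion]
    exact ⟨(s, t), Finset.mem_univ _, (i, j), hxy, rfl⟩
  refine (Set.ncard_le_ncard hcover (Set.toFinite _)).trans ?_
  refine (Finset.set_ncard_biUnion_le _ _).trans ?_
  refine (Finset.sum_le_card_nsmul _ _ (mEx m M) fun s _ =>
    (Set.ncard_image_le (Set.toFinite _)).trans (ncard_le_mEx (hB s))).trans ?_
  simp [sq]

theorem le_ceilDiv_mul (n k : ℕ) : n ≤ (n + k) / (k + 1) * (k + 1) := by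
  have h₁ := Nat.div_add_mod (n + k) (k + 1)
  have h₂ := Nat.mod_lt (n + k) (Nat.succ_pos k)
  rw [mul_comm] at h₁
  simp only [Nat.succ_eq_add_one] at h₂
  omega

theorem blowup_size_le {a n k : ℕ} (hn : 0 < n) (h : a ≤ (n + k) / (k + 1)) :
    (k + 1) * (a - 1) + 1 ≤ n := by
  rw [Nat.le_div_iff_mul_le (by omega : 0 < k + 1)] at h
  cases a with
  | zero => simpa using Nat.one_le_of_lt hn
  | succ a =>
    rw [add_mul, mul_comm a] at h
    simp only [Nat.add_sub_cancel]
    omega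

theorem mEx_blowup_of_forall_not {a b : ℕ} {M : Fin a → Fin b → Prop} {n : ℕ} (k : ℕ)
    (hn : 0 < n) (hM : ∀ i j, ¬ M i j) :
    mEx n (blowup M k) ≤ (k + 1) ^ 2 * mEx ((n + k) / (k + 1)) M := by
  refine mEx_le fun A hA => ?_
  have hfull : ¬ MContains (fun _ _ : Fin ((n + k) / (k + 1)) => True) M := by
    rintro ⟨r, c, hr, hc, -⟩
    have har : a ≤ (n + k) / (k + 1) := by simpa using Fintype.card_le_of_injective r hr.injective
    have hbc : b ≤ (n + k) / (k + 1) := by simpa using Fintype.card_le_of_injective c hc.injective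
    exact hA ⟨Fin.castLE (blowup_size_le hn har), Fin.castLE (blowup_size_le hn hbc),
      Fin.strictMono_castLE _, Fin.strictMono_castLE _,
      fun _ _ ⟨i, j, hij, _⟩ => (hM i j hij).elim⟩
  calc {p : Fin n × Fin n | A p.1 p.2}.ncard ≤ n * n := by
        simpa using Set.ncard_le_card {p : Fin n × Fin n | A p.1 p.2}
    _ ≤ ((n + k) / (k + 1) * (k + 1)) * ((n + k) / (k + 1) * (k + 1)) :=
        Nat.mul_le_mul (le_ceilDiv_mul n k) (le_ceilDiv_mul n k)
    _ = (k + 1) ^ 2 * ((n + k) / (k + 1) * ((n + k) / (k + 1))) := by ring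
    _ ≤ (k + 1) ^ 2 * mEx ((n + k) / (k + 1)) M := by
        refine Nat.mul_le_mul_left _ (le_trans ?_ (ncard_le_mEx hfull))
        simp [Set.ncard_univ]

theorem mEx_blowup {a b : ℕ} (M : Fin a → Fin b → Prop) (n k : ℕ) (hn : 0 < n) (hk : 0 < k) :
    mEx n (blowup M k) ≤ (k + 1) ^ 2 * mEx ((n + k) / (k + 1)) M := by
  by_cases hM : ∃ i j, M i j
  · obtain ⟨i, j, hij⟩ := hM
    have hi := i.isLt
    have hj := j.isLt
    refine (mEx_mono (le_ceilDiv_mul n k) ?_).trans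
      (mEx_mul_blowup _ k (by omega) (by omega))
    exact ⟨⟨(k + 1) * i, Nat.lt_succ_of_le (Nat.mul_le_mul_left _ (by omega))⟩,
      ⟨(k + 1) * j, Nat.lt_succ_of_le (Nat.mul_le_mul_left _ (by omega))⟩, i, j, hij, rfl, rfl⟩
  · push Not at hM
    exact mEx_blowup_of_forall_not k hn hM
end

section
/- For every nonempty finite subset P ⊆ ℝ² there exists a constant c > 0 (depending on P) such that px(n, P) ≥ c · ex(n, M_P) for every positive integer n. -/
open MeasureTheory Set
open scoped ENNReal

/-- A strictly increasing finite sequence of reals has all gaps bounded below, uniformly for all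
small enough positive bounds. -/
lemma StrictMono.eventually_le_gap {b : ℕ} {x : Fin b → ℝ} (hx : StrictMono x) :
    ∀ᶠ δ : ℝ in nhdsWithin 0 (Ioi 0), ∀ i j, i < j → δ ≤ x j - x i := by
  simp only [Filter.eventually_all]
  intro i j hij
  exact Filter.Eventually.filter_mono nhdsWithin_le_nhds
    (Iic_mem_nhds (sub_pos.2 (hx hij)))

/-- Two strips of width at most `1` with integer left ends that meet are equal. -/
lemma nat_eq_of_mem_strips {δ t : ℝ} (hδ : δ ≤ 1) {i j : ℕ}
    (hi : t ∈ Ioo (i : ℝ) (i + δ)) (hj : t ∈ Ioo (j : ℝ) (j + δ)) : i = j := by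
  have h₁ : (i : ℝ) < (j + 1 : ℕ) := by push_cast; linarith [hi.1, hj.2]
  have h₂ : (j : ℝ) < (i + 1 : ℕ) := by push_cast; linarith [hj.1, hi.2]
  have h₁' := Nat.cast_lt.1 h₁
  have h₂' := Nat.cast_lt.1 h₂
  omega

/-- Values at least `δ` apart that lie in strips of width `δ` at integer positions lie in strips
of increasing position. -/
lemma strip_lt_of_gap {δ s t : ℝ} {i j : ℕ} (hs : s ∈ Ioo (i : ℝ) (i + δ))
    (ht : t ∈ Ioo (j : ℝ) (j + δ)) (h : δ ≤ t - s) : i < j := by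
  have : (i : ℝ) < j := by linarith [hs.1, ht.2]
  exact_mod_cast this

/-- The open square of side `δ` representing the matrix entry in row `p.1`, column `p.2`. -/
def entrySquare {n : ℕ} (δ : ℝ) (p : Fin n × Fin n) : Set (ℝ × ℝ) :=
  Ioo ((p.2 : ℕ) : ℝ) ((p.2 : ℕ) + δ) ×ˢ Ioo ((p.1.rev : ℕ) : ℝ) ((p.1.rev : ℕ) + δ)

/-- The union of the squares of the one-entries of `A`. -/
def entryRegion {n : ℕ} (δ : ℝ) (A : Fin n → Fin n → Prop) : Set (ℝ × ℝ) :=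
  ⋃ p ∈ {p : Fin n × Fin n | A p.1 p.2}, entrySquare δ p

lemma isOpen_entryRegion {n : ℕ} (δ : ℝ) (A : Fin n → Fin n → Prop) :
    IsOpen (entryRegion δ A) :=
  isOpen_biUnion fun _ _ => isOpen_Ioo.prod isOpen_Ioo

lemma entryRegion_subset {n : ℕ} {δ : ℝ} (hδ : δ ≤ 1) (A : Fin n → Fin n → Prop) :
    entryRegion δ A ⊆ Icc (0, 0) ((n : ℝ), (n : ℝ)) := by
  have bound : ∀ (i : Fin n) (t : ℝ), t ∈ Ioo ((i : ℕ) : ℝ) ((i : ℕ) + δ) → 0 ≤ t ∧ t ≤ n := by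
    intro i t ht
    have h₀ : (0 : ℝ) ≤ (i : ℕ) := Nat.cast_nonneg _
    have h₁ : (((i : ℕ) + 1 : ℕ) : ℝ) ≤ n := Nat.cast_le.2 i.isLt
    push_cast at h₁
    exact ⟨h₀.trans ht.1.le, by linarith [ht.2]⟩
  refine iUnion₂_subset fun p _ q hq => ?_
  have h₁ := bound _ _ hq.1
  have h₂ := bound _ _ hq.2
  exact ⟨⟨h₁.1, h₂.1⟩, ⟨h₁.2, h₂.2⟩⟩

lemma volume_entryRegion {n : ℕ} {δ : ℝ} (hδ₀ : 0 ≤ δ) (hδ : δ ≤ 1) (A : Fin n → Fin n → Prop) :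
    volume (entryRegion δ A) =
      ENNReal.ofReal (δ ^ 2 * ({p : Fin n × Fin n | A p.1 p.2}.ncard : ℝ)) := by
  classical
  have hfin : {p : Fin n × Fin n | A p.1 p.2}.Finite := Set.toFinite _
  have hcoe : entryRegion δ A = ⋃ p ∈ hfin.toFinset, entrySquare δ p := by
    simp [entryRegion]
  rw [hcoe, measure_biUnion_finset, Set.ncard_eq_toFinset_card _ hfin]
  · have hv : ∀ p : Fin n × Fin n, volume (entrySquare δ p) = ENNReal.ofReal (δ ^ 2) := by
      intro p
      rw [entrySquare, Measure.volume_eq_prod, Measure.prod_prod, Real.volume_Ioo,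
        Real.volume_Ioo, add_sub_cancel_left, add_sub_cancel_left, sq, ENNReal.ofReal_mul hδ₀]
    rw [Finset.sum_congr rfl fun p _ => hv p, Finset.sum_const, nsmul_eq_mul,
      ENNReal.ofReal_mul (sq_nonneg δ), ENNReal.ofReal_natCast, mul_comm]
  · intro p _ q _ hpq
    refine Set.disjoint_left.2 fun t hp hq => hpq ?_
    have h₁ := nat_eq_of_mem_strips hδ hp.1 hq.1
    have h₂ := nat_eq_of_mem_strips hδ hp.2 hq.2
    exact Prod.ext (Fin.rev_injective (Fin.ext h₂)) (Fin.ext h₁)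
  · exact fun p _ => measurableSet_Ioo.prod measurableSet_Ioo

/-- If the gaps of `P` are at least `δ` and the region of `A` contains `P`, then `A` contains the
pattern of `P`. -/
lemma mContains_of_pContains_entryRegion {P : Set (ℝ × ℝ)} {a b n : ℕ} {x : Fin b → ℝ}
    {y : Fin a → ℝ} (hxr : Set.range x = Prod.fst '' P) (hyr : Set.range y = Prod.snd '' P)
    (hx : StrictMono x) (hy : StrictMono y) {δ : ℝ} (hδ : δ ≤ 1)
    (hxδ : ∀ i j, i < j → δ ≤ x j - x i) (hyδ : ∀ i j, i < j → δ ≤ y j - y i)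
    {A : Fin n → Fin n → Prop} (h : PContains (entryRegion δ A) P) :
    MContains A (fun i j => (x j, y (Fin.rev i)) ∈ P) := by
  obtain ⟨fX, fY, hX, hY, hS⟩ := h
  have hmem : ∀ p ∈ P, ∃ q : Fin n × Fin n, A q.1 q.2 ∧ (fX p.1, fY p.2) ∈ entrySquare δ q := by
    intro p hp
    simpa [entryRegion] using hS p hp
  have hxP : ∀ j, ∃ t, (x j, t) ∈ P := by
    intro j
    obtain ⟨⟨u, v⟩, hp, rfl : u = x j⟩ : x j ∈ Prod.fst '' P := hxr ▸ Set.mem_range_self j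
    exact ⟨v, hp⟩
  have hyP : ∀ i, ∃ t, (t, y i) ∈ P := by
    intro i
    obtain ⟨⟨u, v⟩, hp, rfl : v = y i⟩ : y i ∈ Prod.snd '' P := hyr ▸ Set.mem_range_self i
    exact ⟨u, hp⟩
  have hcol : ∀ j, ∃ c : Fin n, fX (x j) ∈ Ioo ((c : ℕ) : ℝ) ((c : ℕ) + δ) := by
    intro j
    obtain ⟨t, ht⟩ := hxP j
    obtain ⟨q, -, hq⟩ := hmem _ ht
    exact ⟨q.2, hq.1⟩
  have hrow : ∀ i, ∃ r : Fin n, fY (y i) ∈ Ioo ((r : ℕ) : ℝ) ((r : ℕ) + δ) := by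
    intro i
    obtain ⟨t, ht⟩ := hyP i
    obtain ⟨q, -, hq⟩ := hmem _ ht
    exact ⟨q.1.rev, hq.2⟩
  choose c hc using hcol
  choose r hr using hrow
  have hr_mono : StrictMono r := fun i j hij =>
    strip_lt_of_gap (hr i) (hr j)
      ((hyδ i j hij).trans (hY _ _ (hyP j) (hyP i) (hy hij)))
  refine ⟨fun i => (r i.rev).rev, c, fun i j hij => ?_, fun i j hij => ?_, fun i j hij => ?_⟩
  · exact Fin.rev_lt_rev.2 (hr_mono (Fin.rev_lt_rev.2 hij))
  · exact strip_lt_of_gap (hc i) (hc j)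
      ((hxδ i j hij).trans (hX _ _ (hxP j) (hxP i) (hx hij)))
  · obtain ⟨⟨q₁, q₂⟩, hA, hq⟩ := hmem _ hij
    have h₁ : q₂ = c j := Fin.ext (nat_eq_of_mem_strips hδ hq.1 (hc j))
    have h₂ : q₁.rev = r i.rev := Fin.ext (nat_eq_of_mem_strips hδ hq.2 (hr i.rev))
    beta_reduce
    rw [← h₁, ← h₂, Fin.rev_rev]
    exact hA

/-- The supremum in `mEx` is attained as soon as it is nonzero. -/
lemma exists_ncard_eq_mEx {n a b : ℕ} {M : Fin a → Fin b → Prop} (h : mEx n M ≠ 0) :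
    ∃ A : Fin n → Fin n → Prop, ¬ MContains A M ∧
      mEx n M = {p : Fin n × Fin n | A p.1 p.2}.ncard := by
  unfold mEx at h ⊢
  set K := {k : ℕ | ∃ A : Fin n → Fin n → Prop, ¬ MContains A M ∧
    k = {p : Fin n × Fin n | A p.1 p.2}.ncard}
  have hne : K.Nonempty := by
    by_contra hK
    rw [Set.not_nonempty_iff_eq_empty] at hK
    simp [hK] at h
  have hbdd : BddAbove K := by
    refine ⟨Nat.card (Fin n × Fin n), ?_⟩
    rintro k ⟨A, -, rfl⟩
    exact Set.ncard_le_card _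
  exact Nat.sSup_mem hne hbdd

theorem px_lower_bound_mEx (P : Set (ℝ × ℝ)) (hPfin : P.Finite) (hPne : P.Nonempty)
    (a b : ℕ) (x : Fin b → ℝ) (y : Fin a → ℝ) (hx : StrictMono x) (hy : StrictMono y)
    (hxr : Set.range x = Prod.fst '' P) (hyr : Set.range y = Prod.snd '' P) :
    ∃ c : ℝ, 0 < c ∧ ∀ n : ℕ, 0 < n →
      ENNReal.ofReal (c * (mEx n (fun i j => (x j, y (Fin.rev i)) ∈ P) : ℝ)) ≤
        px (n : ℝ) P := by
  have hmem : ∀ᶠ δ : ℝ in nhdsWithin 0 (Ioi 0), δ ∈ Ioc 0 1 := Ioc_mem_nhdsGT one_pos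
  obtain ⟨δ, ⟨hδ₀, hδ⟩, hxδ, hyδ⟩ :=
    (hmem.and (hx.eventually_le_gap.and hy.eventually_le_gap)).exists
  refine ⟨δ ^ 2, by positivity, fun n _ => ?_⟩
  rcases eq_or_ne (mEx n fun i j => (x j, y (Fin.rev i)) ∈ P) 0 with h₀ | h₀
  · simp [h₀]
  obtain ⟨A, hA, hk⟩ := exists_ncard_eq_mEx h₀
  rw [hk, ← volume_entryRegion hδ₀.le hδ]
  exact le_sSup ⟨entryRegion δ A, isOpen_entryRegion δ A, entryRegion_subset hδ A,
    fun h => hA (mContains_of_pContains_entryRegion hxr hyr hx hy hδ hxδ hyδ h), rfl⟩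
end

section
/- Let s, t ≥ 1 be integers and let P = X × Y ⊆ ℝ², where X ⊆ ℝ is a finite set with exactly t elements and Y ⊆ ℝ is a finite set with exactly s elements (so P has s rows, t columns, and s·t points). Then there exists a constant C > 0 (depending on P) such that px(n, P) ≤ C · n^{2 − 1/t} for every real n ≥ 1. -/
open MeasureTheory Set
open scoped ENNReal

/-- A `t`-column, `s`-row Kővári–Sós–Turán bound for relations on `{0, …, M - 1}`, in power form. -/
theorem kst_sum_pow_le {s t M : ℕ} (r : ℕ → ℕ → Prop) [DecidableRel r]
    (hfree : ∀ T U : Finset ℕ, T ⊆ Finset.range M → U ⊆ Finset.range M → T.card = t →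
      U.card = s → ¬ ∀ i ∈ T, ∀ j ∈ U, r i j) :
    ∑ j ∈ Finset.range M, (((Finset.range M).filter (r · j)).card + 1 - t) ^ t ≤ s * M ^ t := by
  classical
  have hcount : ∑ j ∈ Finset.range M, ((Finset.range M).filter (r · j)).card.choose t
      ≤ M.choose t * s := by
    have hsum := Finset.sum_card_bipartiteAbove_eq_sum_card_bipartiteBelow
      (s := Finset.range M) (t := (Finset.range M).powersetCard t)
      (fun j T => ∀ i ∈ T, r i j)
    have hrow : ∀ j ∈ Finset.range M, ((Finset.range M).filter (r · j)).card.choose t =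
        (Finset.bipartiteAbove (fun j T => ∀ i ∈ T, r i j)
          ((Finset.range M).powersetCard t) j).card := by
      intro j _
      rw [← Finset.card_powersetCard]
      congr 1
      ext T
      simp only [Finset.mem_powersetCard, Finset.bipartiteAbove, Finset.mem_filter,
        Finset.subset_iff]
      grind
    rw [Finset.sum_congr rfl hrow, hsum]
    refine (Finset.sum_le_card_nsmul _ _ s ?_).trans ?_
    · intro T hT
      rw [Finset.mem_powersetCard] at hT
      by_contra! hlt
      obtain ⟨U, hU, hUs⟩ := Finset.exists_subset_card_eq hlt.le
      refine hfree T U hT.1 (hU.trans (Finset.filter_subset _ _)) hT.2 hUs fun i hi j hj => ?_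
      exact (Finset.mem_filter.1 (hU hj)).2 i hi
    · simp
  calc ∑ j ∈ Finset.range M, (((Finset.range M).filter (r · j)).card + 1 - t) ^ t
      ≤ ∑ j ∈ Finset.range M, t.factorial * ((Finset.range M).filter (r · j)).card.choose t := by
        refine Finset.sum_le_sum fun j _ => ?_
        rw [← Nat.descFactorial_eq_factorial_mul_choose]
        exact Nat.pow_sub_le_descFactorial _ _
    _ = t.factorial * ∑ j ∈ Finset.range M, ((Finset.range M).filter (r · j)).card.choose t := by
        rw [Finset.mul_sum]
    _ ≤ t.factorial * (M.choose t * s) := Nat.mul_le_mul_left _ hcount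
    _ = s * M.descFactorial t := by rw [Nat.descFactorial_eq_factorial_mul_choose]; ring
    _ ≤ s * M ^ t := Nat.mul_le_mul_left _ (Nat.descFactorial_le_pow _ _)

/-- The Kővári–Sós–Turán theorem for relations on `{0, …, M - 1}`. -/
theorem kst_sum_card_le {s t M : ℕ} (hs : 1 ≤ s) (ht : 1 ≤ t) (hM : 1 ≤ M)
    (r : ℕ → ℕ → Prop) [DecidableRel r]
    (hfree : ∀ T U : Finset ℕ, T ⊆ Finset.range M → U ⊆ Finset.range M → T.card = t →
      U.card = s → ¬ ∀ i ∈ T, ∀ j ∈ U, r i j) :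
    (∑ j ∈ Finset.range M, (((Finset.range M).filter (r · j)).card : ℝ))
      ≤ (s + t) * (M : ℝ) ^ (2 - 1 / (t : ℝ)) := by
  have hM' : (1 : ℝ) ≤ M := by exact_mod_cast hM
  have hs' : (1 : ℝ) ≤ s := by exact_mod_cast hs
  have ht' : (1 : ℝ) ≤ t := by exact_mod_cast ht
  have hM0 : (0 : ℝ) < M := by linarith
  set e : ℕ → ℕ := fun j => ((Finset.range M).filter (r · j)).card + 1 - t with he
  have hpow : (∑ j ∈ Finset.range M, (e j : ℝ) ^ t) ≤ s * (M : ℝ) ^ t := by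
    exact_mod_cast kst_sum_pow_le r hfree
  have hroot : (∑ j ∈ Finset.range M, (e j : ℝ)) ≤ s * (M : ℝ) ^ (2 - 1 / (t : ℝ)) := by
    rw [← pow_le_pow_iff_left₀ (by positivity) (by positivity) (by omega : t ≠ 0)]
    obtain ⟨k, hk⟩ : ∃ k, t = k + 1 := ⟨t - 1, by omega⟩
    have hmean := pow_sum_div_card_le_sum_pow (s := Finset.range M) (f := fun j => (e j : ℝ))
      (fun j _ => Nat.cast_nonneg _) k
    rw [div_le_iff₀ (by simpa using pow_pos hM0 k), Finset.card_range, ← hk] at hmean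
    have hexp : ((M : ℝ) ^ (2 - 1 / (t : ℝ))) ^ t = M ^ t * M ^ k := by
      rw [← Real.rpow_mul_natCast hM0.le, ← pow_add, ← Real.rpow_natCast]
      congr 1
      have htk : (t : ℝ) = k + 1 := by exact_mod_cast hk
      push_cast
      field_simp
      linarith
    calc (∑ j ∈ Finset.range M, (e j : ℝ)) ^ t ≤ (∑ j ∈ Finset.range M, (e j : ℝ) ^ t) * M ^ k :=
          hmean
      _ ≤ s * M ^ t * M ^ k := by gcongr
      _ ≤ s ^ t * (M ^ t * M ^ k) := by
          rw [mul_assoc]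
          gcongr
          exact le_self_pow₀ hs' (by omega)
      _ = (s * (M : ℝ) ^ (2 - 1 / (t : ℝ))) ^ t := by rw [mul_pow, hexp]
  have hlin : (M : ℝ) ≤ (M : ℝ) ^ (2 - 1 / (t : ℝ)) := by
    conv_lhs => rw [← Real.rpow_one (M : ℝ)]
    refine Real.rpow_le_rpow_of_exponent_le hM' ?_
    have : 1 / (t : ℝ) ≤ 1 := by rw [div_le_one (by linarith)]; exact ht'
    linarith
  calc (∑ j ∈ Finset.range M, (((Finset.range M).filter (r · j)).card : ℝ))
      ≤ ∑ j ∈ Finset.range M, ((e j : ℝ) + t) := by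
        refine Finset.sum_le_sum fun j _ => ?_
        have : ((Finset.range M).filter (r · j)).card ≤ e j + t := by simp only [he]; omega
        exact_mod_cast this
    _ = (∑ j ∈ Finset.range M, (e j : ℝ)) + M * t := by simp [Finset.sum_add_distrib]
    _ ≤ (s + t) * (M : ℝ) ^ (2 - 1 / (t : ℝ)) := by nlinarith

/-- A finite set of reals maps strictly monotonically into any finset of naturals of the same
cardinality. -/
theorem exists_strictMonoOn_mem_finset {X : Set ℝ} (hX : X.Finite) (T : Finset ℕ)
    (hT : T.card = X.ncard) : ∃ g : ℝ → ℕ, StrictMonoOn g X ∧ ∀ x ∈ X, g x ∈ T := by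
  classical
  lift X to Finset ℝ using hX
  rw [Set.ncard_coe_finset] at hT
  refine ⟨fun x => if h : x ∈ X then T.orderIsoOfFin hT ((X.orderIsoOfFin rfl).symm ⟨x, h⟩) else 0,
    ?_, ?_⟩
  · intro x hx y hy hxy
    rw [Finset.mem_coe] at hx hy
    simp only [hx, hy, dif_pos]
    rw [Subtype.coe_lt_coe, OrderIso.lt_iff_lt, OrderIso.lt_iff_lt]
    exact hxy
  · intro x hx
    rw [Finset.mem_coe] at hx
    simp only [hx, dif_pos]
    exact Subtype.coe_prop _

/-- A strictly monotone integer labelling, dilated by a bound on the diameter, is expanding. -/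
theorem exists_expanding_map_s11 {X : Set ℝ} (hX : X.Finite) (T : Finset ℕ) (hT : T.card = X.ncard)
    {D : ℝ} (hD : 0 ≤ D) (hXD : ∀ x ∈ X, ∀ x' ∈ X, x - x' ≤ D) (a : ℝ) :
    ∃ f : ℝ → ℝ, (∀ x ∈ X, ∀ x' ∈ X, x' < x → x - x' ≤ f x - f x') ∧
      ∀ x ∈ X, ∃ i ∈ T, f x = D * i + a := by
  obtain ⟨g, hg, hgT⟩ := exists_strictMonoOn_mem_finset hX T hT
  refine ⟨fun x => D * g x + a, fun x hx x' hx' hlt => ?_, fun x hx => ⟨g x, hgT x hx, rfl⟩⟩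
  have hstep : (g x' : ℝ) + 1 ≤ g x := by exact_mod_cast hg hx' hx hlt
  have := hXD x hx x' hx'
  nlinarith

/-- A set containing a sufficiently spread grid contains every grid with as many columns and
rows. -/
theorem pContains_prod_of_grid {X Y : Set ℝ} (hX : X.Finite) (hY : Y.Finite) {T U : Finset ℕ}
    (hT : T.card = X.ncard) (hU : U.card = Y.ncard) {D : ℝ} (hD : 0 ≤ D)
    (hXD : ∀ x ∈ X, ∀ x' ∈ X, x - x' ≤ D) (hYD : ∀ y ∈ Y, ∀ y' ∈ Y, y - y' ≤ D)
    {S : Set (ℝ × ℝ)} (a b : ℝ) (hS : ∀ i ∈ T, ∀ j ∈ U, (D * i + a, D * j + b) ∈ S) :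
    PContains S (X ×ˢ Y) := by
  obtain ⟨f, hf, hfT⟩ := exists_expanding_map_s11 hX T hT hD hXD a
  obtain ⟨g, hg, hgU⟩ := exists_expanding_map_s11 hY U hU hD hYD b
  refine ⟨f, g, ?_, ?_, ?_⟩
  · rintro x₀ x₁ ⟨_, h₀, _⟩ ⟨_, h₁, _⟩
    exact hf x₀ h₀ x₁ h₁
  · rintro y₀ y₁ ⟨_, _, h₀⟩ ⟨_, _, h₁⟩
    exact hg y₀ h₀ y₁ h₁
  · rintro ⟨x, y⟩ ⟨hx, hy⟩
    obtain ⟨i, hi, hfi⟩ := hfT x hx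
    obtain ⟨j, hj, hgj⟩ := hgU y hy
    simp only [hfi, hgj]
    exact hS i hi j hj

open Classical in
/-- Averaging over translates of a lattice: if every translate of the `M × M` grid of mesh `D` meets
`S` in at most `B` points, then `S` has area at most `B * D ^ 2`. -/
theorem volume_le_of_grid_count_le {S : Set (ℝ × ℝ)} (hS : MeasurableSet S) {n D B : ℝ}
    (hSn : S ⊆ Icc (0, 0) (n, n)) (hD : 0 < D) {M : ℕ} (hM : n < D * M)
    (hB : ∀ p : ℝ × ℝ, ∑ j ∈ Finset.range M,
      (((Finset.range M).filter fun i : ℕ => (D * i + p.1, D * j + p.2) ∈ S).card : ℝ) ≤ B) :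
    volume S ≤ ENNReal.ofReal (B * D ^ 2) := by
  set Q : Set (ℝ × ℝ) := Ico 0 D ×ˢ Ico 0 D with hQ
  have hQm : MeasurableSet Q := measurableSet_Ico.prod measurableSet_Ico
  set v : ℕ → ℕ → ℝ × ℝ := fun i j => (D * i, D * j) with hv
  set A : ℕ → ℕ → Set (ℝ × ℝ) := fun i j => (v i j + ·) ⁻¹' S with hA
  have hAm : ∀ i j, MeasurableSet (A i j) := fun i j => (measurable_const_add _) hS
  have hfloor : ∀ x : ℝ, 0 ≤ x → x ≤ n → ∃ i < M, x - D * (i : ℝ) ∈ Ico 0 D := by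
    intro x hx hxn
    have hle := Nat.floor_le (div_nonneg hx hD.le)
    have hlt := Nat.lt_floor_add_one (x / D)
    rw [le_div_iff₀ hD] at hle
    rw [div_lt_iff₀ hD] at hlt
    refine ⟨⌊x / D⌋₊, ?_, by constructor <;> nlinarith⟩
    rw [Nat.floor_lt (div_nonneg hx hD.le), div_lt_iff₀ hD]
    linarith
  have hcover : S ⊆ ⋃ j ∈ Finset.range M, ⋃ i ∈ Finset.range M,
      (-v i j + ·) ⁻¹' (A i j ∩ Q) := by
    rintro ⟨x, y⟩ hp
    obtain ⟨⟨hx, hy⟩, hxn, hyn⟩ := hSn hp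
    obtain ⟨i, hi, hxi⟩ := hfloor x hx hxn
    obtain ⟨j, hj, hyj⟩ := hfloor y hy hyn
    simp only [mem_iUnion, Finset.mem_range]
    refine ⟨j, hj, i, hi, ?_, ?_⟩
    · simpa [hA] using hp
    · simp only [hQ, hv, mem_prod, neg_add_eq_sub]
      exact ⟨hxi, hyj⟩
  have hpoint : ∀ p, ∑ j ∈ Finset.range M, ∑ i ∈ Finset.range M,
      (A i j).indicator (1 : ℝ × ℝ → ℝ≥0∞) p ≤ ENNReal.ofReal B := by
    intro p
    have hcard : ∀ j, ∑ i ∈ Finset.range M, (A i j).indicator (1 : ℝ × ℝ → ℝ≥0∞) p =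
        (((Finset.range M).filter fun i : ℕ => (D * i + p.1, D * j + p.2) ∈ S).card : ℝ≥0∞) := by
      intro j
      rw [Finset.card_filter, Nat.cast_sum]
      refine Finset.sum_congr rfl fun i _ => ?_
      simp only [Set.indicator_apply, hA, hv, mem_preimage, Pi.one_apply, Nat.cast_ite,
        Nat.cast_one, Nat.cast_zero]
      rfl
    simp_rw [hcard]
    rw [← Nat.cast_sum, ← ENNReal.ofReal_natCast]
    refine ENNReal.ofReal_le_ofReal ?_
    rw [Nat.cast_sum]
    exact hB p
  calc volume S
      ≤ ∑ j ∈ Finset.range M, ∑ i ∈ Finset.range M, volume ((-v i j + ·) ⁻¹' (A i j ∩ Q)) :=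
        (measure_mono hcover).trans <| (measure_biUnion_finset_le _ _).trans <|
          Finset.sum_le_sum fun _ _ => measure_biUnion_finset_le _ _
    _ = ∑ j ∈ Finset.range M, ∑ i ∈ Finset.range M,
          ∫⁻ p in Q, (A i j).indicator (1 : ℝ × ℝ → ℝ≥0∞) p := by
        simp_rw [measure_preimage_add, lintegral_indicator_one (hAm _ _),
          Measure.restrict_apply (hAm _ _)]
    _ = ∫⁻ p in Q, ∑ j ∈ Finset.range M, ∑ i ∈ Finset.range M,
          (A i j).indicator (1 : ℝ × ℝ → ℝ≥0∞) p := by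
        have hm : ∀ i j, Measurable ((A i j).indicator (1 : ℝ × ℝ → ℝ≥0∞)) :=
          fun i j => measurable_one.indicator (hAm i j)
        rw [lintegral_finsetSum _ fun j _ => Finset.measurable_fun_sum _ fun i _ => hm i j]
        exact Finset.sum_congr rfl fun j _ => (lintegral_finsetSum _ fun i _ => hm i j).symm
    _ ≤ ∫⁻ _ in Q, ENNReal.ofReal B := lintegral_mono hpoint
    _ = ENNReal.ofReal (B * D ^ 2) := by
        have hB0 : 0 ≤ B := (Finset.sum_nonneg fun _ _ => Nat.cast_nonneg _).trans (hB 0)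
        rw [setLIntegral_const, hQ, Measure.volume_eq_prod, Measure.prod_prod, Real.volume_Ico,
          sub_zero, ← ENNReal.ofReal_mul hD.le, ← ENNReal.ofReal_mul hB0, sq]

theorem px_grid_kst (s t : ℕ) (hs : 1 ≤ s) (ht : 1 ≤ t) (X Y : Set ℝ)
    (hXfin : X.Finite) (hXcard : X.ncard = t) (hYfin : Y.Finite) (hYcard : Y.ncard = s) :
    ∃ C : ℝ, 0 < C ∧ ∀ n : ℝ, 1 ≤ n →
      px n (X ×ˢ Y) ≤ ENNReal.ofReal (C * n ^ (2 - 1 / (t : ℝ))) := by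
  classical
  set D : ℝ := max 1 (max (Metric.diam X) (Metric.diam Y)) with hDdef
  have hD1 : 1 ≤ D := le_max_left _ _
  have hXD : ∀ x ∈ X, ∀ x' ∈ X, x - x' ≤ D := fun x hx x' hx' =>
    (le_abs_self _).trans <| (Metric.dist_le_diam_of_mem hXfin.isBounded hx hx').trans <|
      (le_max_left _ _).trans (le_max_right _ _)
  have hYD : ∀ y ∈ Y, ∀ y' ∈ Y, y - y' ≤ D := fun y hy y' hy' =>
    (le_abs_self _).trans <| (Metric.dist_le_diam_of_mem hYfin.isBounded hy hy').trans <|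
      (le_max_right _ _).trans (le_max_right _ _)
  have hs' : (1 : ℝ) ≤ s := by exact_mod_cast hs
  have ht' : (1 : ℝ) ≤ t := by exact_mod_cast ht
  set α : ℝ := 2 - 1 / (t : ℝ) with hα
  have hα0 : 0 ≤ α := by
    have : 1 / (t : ℝ) ≤ 1 := by rw [div_le_one (by linarith)]; exact ht'
    linarith
  refine ⟨(s + t) * 2 ^ α * D ^ 2, by positivity, fun n hn => sSup_le ?_⟩
  rintro _ ⟨S, hSo, hSn, hfree, rfl⟩
  set M : ℕ := ⌊n⌋₊ + 1 with hMdef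
  have hnM : n < M := by
    rw [hMdef]
    push_cast
    exact Nat.lt_floor_add_one n
  have hMn : (M : ℝ) ≤ 2 * n := by
    have := Nat.floor_le (by linarith : (0 : ℝ) ≤ n)
    rw [hMdef]
    push_cast
    linarith
  refine (volume_le_of_grid_count_le hSo.measurableSet hSn (by linarith) (M := M)
    (by nlinarith : n < D * M) (B := (s + t) * (M : ℝ) ^ α) fun p => ?_).trans ?_
  · convert kst_sum_card_le hs ht (by omega : 1 ≤ M)
      (fun i j => (D * i + p.1, D * j + p.2) ∈ S) ?_
    intro T U _ _ hT hU hTU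
    exact hfree (pContains_prod_of_grid hXfin hYfin (hT.trans hXcard.symm) (hU.trans hYcard.symm)
      (by linarith) hXD hYD p.1 p.2 hTU)
  · refine ENNReal.ofReal_le_ofReal ?_
    have hpow : (M : ℝ) ^ α ≤ 2 ^ α * n ^ α := by
      rw [← Real.mul_rpow (by norm_num) (by linarith)]
      exact Real.rpow_le_rpow (by positivity) hMn hα0
    calc (s + t) * (M : ℝ) ^ α * D ^ 2 ≤ (s + t) * (2 ^ α * n ^ α) * D ^ 2 := by gcongr
      _ = (s + t) * 2 ^ α * D ^ 2 * n ^ α := by ring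
end

section
/- Let P ⊆ ℝ² be a nonempty open set and let Q_P = P ∩ ℚ² be the set of points of P with both coordinates rational. Then px(n, Q_P) ≤ n² for all real n > 0, and there exist constants c > 0 and n₀ > 0 (depending on P) such that px(n, Q_P) ≥ c · n² for every real n ≥ n₀. In particular, px(n, Q_P) = Θ(n²). -/
open MeasureTheory Set
open scoped ENNReal

/-- The `i`-th open cell of the grid of mesh `h` on the half-line. -/
def gridCell (h : ℝ) (i : ℕ) : Set ℝ := Ioo (i * h) ((i + 1) * h)

theorem isOpen_gridCell (h : ℝ) (i : ℕ) : IsOpen (gridCell h i) := isOpen_Ioo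

theorem sub_lt_of_mem_gridCell {h x y : ℝ} {i : ℕ} (hx : x ∈ gridCell h i)
    (hy : y ∈ gridCell h i) : y - x < h := by
  have h1 := hx.1
  have h2 := hy.2
  linarith

theorem gridCell_disjoint {h : ℝ} (hh : 0 < h) {i j : ℕ} (hij : i ≠ j) :
    Disjoint (gridCell h i) (gridCell h j) := by
  wlog hlt : i < j generalizing i j
  · exact (this hij.symm (by omega)).symm
  refine Set.disjoint_left.2 fun x hx hy => ?_
  have h1 : ((i : ℝ) + 1) ≤ j := by exact_mod_cast hlt
  have h2 := hx.2
  have h3 := hy.1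
  nlinarith

theorem gridCell_subset_Icc {n : ℝ} (hn : 0 < n) {N i : ℕ} (hi : i < N) :
    gridCell (n / N) i ⊆ Icc 0 n := by
  have hN : (0 : ℝ) < N := by exact_mod_cast (Nat.zero_le i).trans_lt hi
  have hi' : (i : ℝ) + 1 ≤ N := by exact_mod_cast hi
  have hh : 0 < n / N := div_pos hn hN
  rintro x ⟨h1, h2⟩
  constructor
  · have : 0 ≤ (i : ℝ) * (n / N) := by positivity
    linarith
  · have : ((i : ℝ) + 1) * (n / N) ≤ N * (n / N) := by gcongr
    have h3 : (N : ℝ) * (n / N) = n := by field_simp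
    linarith

theorem volume_gridCell (h : ℝ) (i : ℕ) : volume (gridCell h i) = ENNReal.ofReal h := by
  rw [gridCell, Real.volume_Ioo]
  congr 1
  ring

/-- The union of the cells of a `d × 2 ^ d` grid on `[0, n]²` at the positions `(i, T)` with `i ∈ T`,
where the columns are indexed by the subsets `T` of `Fin d` through `e`. -/
def membershipGrid (n : ℝ) (d : ℕ) (e : Finset (Fin d) ≃ Fin (2 ^ d)) : Set (ℝ × ℝ) :=
  ⋃ p ∈ (Finset.univ.filter fun p : Fin d × Finset (Fin d) => p.1 ∈ p.2),
    gridCell (n / d) p.1 ×ˢ gridCell (n / (2 ^ d : ℕ)) (e p.2)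

theorem mem_membershipGrid {n : ℝ} {d : ℕ} {e : Finset (Fin d) ≃ Fin (2 ^ d)} {z : ℝ × ℝ} :
    z ∈ membershipGrid n d e ↔ ∃ (i : Fin d) (T : Finset (Fin d)), i ∈ T ∧
      z.1 ∈ gridCell (n / d) i ∧ z.2 ∈ gridCell (n / (2 ^ d : ℕ)) (e T) := by
  simp only [membershipGrid, Set.mem_iUnion, Finset.mem_filter, Finset.mem_univ, true_and,
    Prod.exists, Set.mem_prod, exists_prop]

theorem isOpen_membershipGrid (n : ℝ) (d : ℕ) (e : Finset (Fin d) ≃ Fin (2 ^ d)) :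
    IsOpen (membershipGrid n d e) :=
  isOpen_biUnion fun _ _ => IsOpen.prod (isOpen_gridCell _ _) (isOpen_gridCell _ _)

theorem membershipGrid_subset {n : ℝ} (hn : 0 < n) (d : ℕ) (e : Finset (Fin d) ≃ Fin (2 ^ d)) :
    membershipGrid n d e ⊆ Icc (0, 0) (n, n) := by
  intro z hz
  obtain ⟨i, T, -, h1, h2⟩ := mem_membershipGrid.1 hz
  have h1 := gridCell_subset_Icc hn i.2 h1
  have h2 := gridCell_subset_Icc hn (e T).2 h2
  exact ⟨⟨h1.1, h2.1⟩, ⟨h1.2, h2.2⟩⟩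

theorem card_filter_subset {d : ℕ} (A : Finset (Fin d)) :
    (Finset.univ.filter fun T : Finset (Fin d) => A ⊆ T).card = 2 ^ (d - A.card) := by
  have : (Finset.univ.filter fun T : Finset (Fin d) => A ⊆ T) = Finset.Icc A Finset.univ := by
    ext T
    simp
  rw [this, Finset.card_Icc_finset (Finset.subset_univ A), Finset.card_univ, Fintype.card_fin]

theorem card_filter_mem (d : ℕ) :
    (Finset.univ.filter fun p : Fin d × Finset (Fin d) => p.1 ∈ p.2).card = d * 2 ^ (d - 1) := by
  rw [Finset.card_filter, Fintype.sum_prod_type]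
  have (i : Fin d) : (∑ T : Finset (Fin d), if i ∈ T then 1 else 0) = 2 ^ (d - 1) := by
    rw [← Finset.card_filter]
    simpa using card_filter_subset {i}
  simp [this]

theorem volume_membershipGrid {n : ℝ} (hn : 0 < n) {d : ℕ} (hd : 0 < d)
    (e : Finset (Fin d) ≃ Fin (2 ^ d)) :
    volume (membershipGrid n d e) = ENNReal.ofReal (1 / 2 * n ^ 2) := by
  have hd' : (0 : ℝ) < d := by exact_mod_cast hd
  rw [membershipGrid, measure_biUnion_finset]
  · have (p : Fin d × Finset (Fin d)) :
        volume (gridCell (n / d) p.1 ×ˢ gridCell (n / (2 ^ d : ℕ)) (e p.2)) =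
          ENNReal.ofReal (n / d * (n / (2 ^ d : ℕ))) := by
      rw [Measure.volume_eq_prod, Measure.prod_prod, volume_gridCell, volume_gridCell,
        ← ENNReal.ofReal_mul (by positivity)]
    simp_rw [this]
    rw [Finset.sum_const, card_filter_mem, ← ENNReal.ofReal_nsmul]
    congr 1
    obtain ⟨m, rfl⟩ : ∃ m, d = m + 1 := ⟨d - 1, by omega⟩
    simp only [Nat.add_sub_cancel, nsmul_eq_mul]
    push_cast at hd' ⊢
    field_simp
    ring
  · rintro ⟨i, T⟩ - ⟨j, U⟩ - hne
    refine Set.disjoint_prod.2 ?_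
    by_cases hij : i = j
    · refine Or.inr (gridCell_disjoint (by positivity) fun h => hne ?_)
      exact Prod.ext hij (e.injective (Fin.ext h))
    · exact Or.inl (gridCell_disjoint (by positivity) fun h => hij (Fin.ext h))
  · exact fun _ _ => (isOpen_gridCell _ _).measurableSet.prod (isOpen_gridCell _ _).measurableSet

theorem exists_rat_separated (a : ℚ) {ε h : ℝ} (hh : 0 < h) {k : ℕ} (hk : 0 < k)
    (hkh : k * h < ε) :
    ∃ x : Fin k → ℚ, (∀ t, (x t : ℝ) ∈ Ico (a : ℝ) (a + ε)) ∧
      ∀ t u, t < u → (x t : ℝ) < x u ∧ h ≤ x u - x t := by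
  have hk' : (0 : ℝ) < k := by exact_mod_cast hk
  obtain ⟨s, hs1, hs2⟩ := exists_rat_btwn ((lt_div_iff₀' hk').2 hkh)
  rw [lt_div_iff₀' hk'] at hs2
  have hs : (0 : ℝ) < s := hh.trans hs1
  refine ⟨fun t => a + (t : ℕ) * s, fun t => ?_, fun t u htu => ?_⟩
  · have ht : ((t : ℕ) : ℝ) < k := by exact_mod_cast t.2
    have h0 : 0 ≤ ((t : ℕ) : ℝ) * s := by positivity
    push_cast
    constructor <;> nlinarith
  · have ht : ((t : ℕ) : ℝ) + 1 ≤ (u : ℕ) := by exact_mod_cast htu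
    push_cast
    constructor <;> nlinarith

theorem injective_of_mem_gridCell {k : ℕ} {h : ℝ} {v : Fin k → ℝ}
    (hv : ∀ t u, t < u → h ≤ v u - v t) {c : Fin k → ℕ} (hc : ∀ t, v t ∈ gridCell h (c t)) :
    Function.Injective c := by
  intro t u htu
  by_contra hne
  wlog hlt : t < u generalizing t u
  · exact this htu.symm (Ne.symm hne) (lt_of_le_of_ne (not_lt.1 hlt) (Ne.symm hne))
  have h1 := sub_lt_of_mem_gridCell (hc t) (htu ▸ hc u)
  linarith [hv t u hlt]

theorem exists_notMem_membershipGrid_of_separated {n : ℝ} {d k l : ℕ}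
    {e : Finset (Fin d) ≃ Fin (2 ^ d)} (hk : 0 < k) (hl : 2 ^ (d - k) < l)
    {v : Fin k → ℝ} {w : Fin l → ℝ}
    (hv : ∀ t u, t < u → n / d ≤ v u - v t)
    (hw : ∀ t u, t < u → n / (2 ^ d : ℕ) ≤ w u - w t)
    (hn : 0 < n) (hd : 0 < d) :
    ∃ t u, (v t, w u) ∉ membershipGrid n d e := by
  by_contra! H
  have hd' : (0 : ℝ) < d := by exact_mod_cast hd
  have h1 (t : Fin k) (u : Fin l) := mem_membershipGrid.1 (H t u)
  choose i T hiT hi hT using h1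
  have hi0 (t : Fin k) (u u' : Fin l) : i t u = i t u' := by
    by_contra hne
    exact Set.disjoint_left.1 (gridCell_disjoint (div_pos hn hd') fun h => hne (Fin.ext h))
      (hi t u) (hi t u')
  have hT0 (t t' : Fin k) (u : Fin l) : T t u = T t' u := by
    by_contra hne
    exact Set.disjoint_left.1 (gridCell_disjoint (by positivity)
      fun h => hne (e.injective (Fin.ext h))) (hT t u) (hT t' u)
  let t₀ : Fin k := ⟨0, hk⟩
  let u₀ : Fin l := ⟨0, (Nat.zero_le _).trans_lt hl⟩
  have hinj : Function.Injective fun t => i t u₀ := fun t t' h =>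
    injective_of_mem_gridCell hv (fun t => hi t u₀) (congrArg Fin.val h)
  have hTinj : Function.Injective (T t₀) := fun u u' h =>
    injective_of_mem_gridCell hw (fun u => hT t₀ u) (congrArg (fun V => (e V : ℕ)) h)
  let A := Finset.univ.image fun t => i t u₀
  have hA : A.card = k := by
    rw [Finset.card_image_of_injective _ hinj, Finset.card_univ, Fintype.card_fin]
  have hsub : Finset.univ.image (T t₀) ⊆ Finset.univ.filter fun V : Finset (Fin d) => A ⊆ V := by
    intro V hV
    obtain ⟨u, -, rfl⟩ := Finset.mem_image.1 hV
    refine Finset.mem_filter.2 ⟨Finset.mem_univ _, fun j hj => ?_⟩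
    obtain ⟨t, -, rfl⟩ := Finset.mem_image.1 hj
    rw [hi0 t u₀ u, hT0 t₀ t u]
    exact hiT t u
  have hcard := Finset.card_le_card hsub
  rw [card_filter_subset, hA, Finset.card_image_of_injective _ hTinj, Finset.card_univ,
    Fintype.card_fin] at hcard
  omega

theorem exists_rat_box_subset {P : Set (ℝ × ℝ)} (hP : IsOpen P) (hPne : P.Nonempty) :
    ∃ (a b : ℚ) (ε : ℝ), 0 < ε ∧ Ico (a : ℝ) (a + ε) ×ˢ Ico (b : ℝ) (b + ε) ⊆ P := by
  obtain ⟨p, hp⟩ := hPne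
  obtain ⟨δ, hδ, hball⟩ := Metric.isOpen_iff.1 hP p hp
  obtain ⟨a, ha1, ha2⟩ := exists_rat_btwn (show p.1 < p.1 + δ / 2 by linarith)
  obtain ⟨b, hb1, hb2⟩ := exists_rat_btwn (show p.2 < p.2 + δ / 2 by linarith)
  refine ⟨a, b, δ / 2, by positivity, fun z ⟨hz1, hz2⟩ => hball ?_⟩
  rw [Metric.mem_ball, Prod.dist_eq, max_lt_iff, Real.dist_eq, Real.dist_eq, abs_lt, abs_lt]
  have := hz1.1
  have := hz1.2
  have := hz2.1
  have := hz2.2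
  refine ⟨⟨?_, ?_⟩, ?_, ?_⟩ <;> linarith

theorem px_le (n : ℝ) (hn : 0 < n) (P : Set (ℝ × ℝ)) : px n P ≤ ENNReal.ofReal (n ^ 2) := by
  refine sSup_le ?_
  rintro m ⟨S, -, hS, -, rfl⟩
  refine (measure_mono hS).trans_eq ?_
  rw [← Icc_prod_Icc, Measure.volume_eq_prod, Measure.prod_prod, Real.volume_Icc, sub_zero,
    ← ENNReal.ofReal_mul hn.le, sq]

theorem px_rational_points_of_open (P : Set (ℝ × ℝ)) (hP : IsOpen P) (hPne : P.Nonempty) :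
    (∀ n : ℝ, 0 < n →
      px n {p ∈ P | (∃ q : ℚ, p.1 = (q : ℝ)) ∧ ∃ q : ℚ, p.2 = (q : ℝ)} ≤
        ENNReal.ofReal (n ^ 2)) ∧
    ∃ c : ℝ, 0 < c ∧ ∃ n₀ : ℝ, 0 < n₀ ∧ ∀ n : ℝ, n₀ ≤ n →
      ENNReal.ofReal (c * n ^ 2) ≤
        px n {p ∈ P | (∃ q : ℚ, p.1 = (q : ℝ)) ∧ ∃ q : ℚ, p.2 = (q : ℝ)} := by
  refine ⟨fun n hn => px_le n hn _, 1 / 2, by norm_num, 1, one_pos, fun n hn1 => ?_⟩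
  have hn : 0 < n := by linarith
  obtain ⟨a, b, ε, hε, hbox⟩ := exists_rat_box_subset hP hPne
  obtain ⟨r, hr⟩ := pow_unbounded_of_one_lt (n / ε) (one_lt_two : (1 : ℝ) < 2)
  rw [div_lt_iff₀ hε] at hr
  let d := 2 ^ r * (r + 1)
  have hd : 0 < d := by positivity
  have hrd : r + 1 ≤ d := Nat.le_mul_of_pos_left _ (by positivity)
  have hd' : (0 : ℝ) < d := by exact_mod_cast hd
  let e : Finset (Fin d) ≃ Fin (2 ^ d) := Fintype.equivFinOfCardEq (by simp)
  refine le_sSup ⟨membershipGrid n d e, isOpen_membershipGrid n d e, membershipGrid_subset hn d e,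
    ?_, (volume_membershipGrid hn hd e).symm⟩
  rintro ⟨fX, fY, hX, hY, hS⟩
  have hrow : ((r + 1 : ℕ) : ℝ) * (n / d) < ε := by
    have : ((r + 1 : ℕ) : ℝ) * (n / d) = n / 2 ^ r := by
      simp only [d]
      push_cast
      field_simp
    rw [this, div_lt_iff₀ (by positivity)]
    linarith
  have hcol : ((2 ^ (d - r) : ℕ) : ℝ) * (n / (2 ^ d : ℕ)) < ε := by
    have h2 : (2 : ℝ) ^ d = 2 ^ (d - r) * 2 ^ r := by
      rw [← pow_add, Nat.sub_add_cancel (by omega)]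
    have : ((2 ^ (d - r) : ℕ) : ℝ) * (n / (2 ^ d : ℕ)) = n / 2 ^ r := by
      push_cast
      rw [h2]
      field_simp
    rw [this, div_lt_iff₀ (by positivity)]
    linarith
  obtain ⟨x, hx, hxs⟩ := exists_rat_separated a (div_pos hn hd') r.succ_pos hrow
  obtain ⟨y, hy, hys⟩ := exists_rat_separated b (by positivity) (by positivity) hcol
  have hQ (t u) : ((x t : ℝ), (y u : ℝ)) ∈
      {p ∈ P | (∃ q : ℚ, p.1 = (q : ℝ)) ∧ ∃ q : ℚ, p.2 = (q : ℝ)} :=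
    ⟨hbox ⟨hx t, hy u⟩, ⟨x t, rfl⟩, y u, rfl⟩
  let t₀ : Fin (r + 1) := 0
  let u₀ : Fin (2 ^ (d - r)) := ⟨0, by positivity⟩
  obtain ⟨t, u, htu⟩ := exists_notMem_membershipGrid_of_separated (e := e) (v := fun t => fX (x t))
    (w := fun u => fY (y u)) r.succ_pos
    (Nat.pow_lt_pow_right one_lt_two (by omega : d - (r + 1) < d - r))
    (fun t u h => (hxs t u h).2.trans
      (hX _ _ ⟨y u₀, hQ u u₀⟩ ⟨y u₀, hQ t u₀⟩ (hxs t u h).1))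
    (fun t u h => (hys t u h).2.trans
      (hY _ _ ⟨x t₀, hQ t₀ u⟩ ⟨x t₀, hQ t₀ t⟩ (hys t u h).1)) hn hd
  exact htu (hS _ (hQ t u))
end

section
/- Let a, b > 0 and let f : [0, a] → ℝ be strictly increasing with f(t) − f(s) ≤ b·(t − s) for all 0 ≤ s < t ≤ a. Let P = {(t, f(t)) : t ∈ [0, a]} be the graph of f. Then for every real n ≥ max(a, ab), a·n ≤ px(n, P) ≤ (a + ab)·n; in particular px(n, P) = Θ(n). -/
open MeasureTheory Set
open scoped ENNReal

/-- The measure of the part of a set to the left of a point is a nonexpansive function of the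
point. -/
theorem volume_real_inter_Iic_sub_le {K : Set ℝ} (hK : volume K ≠ ⊤) {x y : ℝ} (hxy : x ≤ y) :
    volume.real (K ∩ Iic y) - volume.real (K ∩ Iic x) ≤ y - x := by
  have hsub : K ∩ Iic y ⊆ (K ∩ Iic x) ∪ Ioc x y := by
    rintro z ⟨hz, hzy⟩
    rcases le_or_gt z x with h | h
    · exact Or.inl ⟨hz, h⟩
    · exact Or.inr ⟨h, hzy⟩
  have h₁ := measureReal_mono (μ := volume) hsub
    (measure_union_ne_top (measure_ne_top_of_subset inter_subset_left hK) measure_Ioc_lt_top.ne)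
  have h₂ := measureReal_union_le (μ := volume) (K ∩ Iic x) (Ioc x y)
  rw [Real.volume_real_Ioc_of_le hxy] at h₂
  linarith

/-- A compact set of reals of measure at least `v > 0` has a point that cuts off measure exactly
`v` to its left. -/
theorem exists_mem_volume_inter_Iic_eq {K : Set ℝ} (hK : IsCompact K) {v : ℝ} (hv : 0 < v)
    (hvK : v ≤ volume.real K) :
    ∃ x ∈ K, volume.real (K ∩ Iic x) = v := by
  have hfin : ∀ x, volume (K ∩ Iic x) ≠ ⊤ := fun x =>
    measure_ne_top_of_subset inter_subset_left hK.measure_lt_top.ne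
  have hmono : ∀ x y : ℝ, x ≤ y → volume.real (K ∩ Iic x) ≤ volume.real (K ∩ Iic y) :=
    fun x y hxy => measureReal_mono (inter_subset_inter_right K (Iic_subset_Iic.2 hxy)) (hfin y)
  have hcont : Continuous fun x => volume.real (K ∩ Iic x) := by
    refine (LipschitzWith.of_le_add fun x y => ?_).continuous
    rw [Real.dist_eq]
    rcases le_total x y with h | h
    · linarith [hmono x y h, abs_nonneg (x - y)]
    · linarith [volume_real_inter_Iic_sub_le hK.measure_lt_top.ne h, le_abs_self (x - y)]
  obtain ⟨l, hl⟩ := hK.bddBelow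
  obtain ⟨u, hu⟩ := hK.bddAbove
  have hlow : volume.real (K ∩ Iic (l - 1)) = 0 := by
    have : K ∩ Iic (l - 1) = ∅ := by
      ext z
      simp only [mem_inter_iff, mem_Iic, mem_empty_iff_false, iff_false, not_and, not_le]
      intro hz
      linarith [hl hz]
    simp [this]
  have hupp : volume.real (K ∩ Iic u) = volume.real K := by
    rw [inter_eq_left.2 (show K ⊆ Iic u from fun z hz => hu hz)]
  obtain ⟨x₀, hx₀⟩ := mem_range_of_exists_le_of_exists_ge hcont
    ⟨l - 1, hlow.trans_le hv.le⟩ ⟨u, hvK.trans_eq hupp.symm⟩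
  have hne : (K ∩ Iic x₀).Nonempty := by
    by_contra h
    rw [not_nonempty_iff_eq_empty] at h
    simp only [h, measureReal_empty] at hx₀
    exact hv.ne hx₀
  obtain ⟨x, ⟨hxK, hxx₀⟩, hmax⟩ := (hK.inter_right isClosed_Iic).exists_isGreatest hne
  refine ⟨x, hxK, ?_⟩
  rw [← hx₀]
  congr 1
  ext z
  exact ⟨fun hz => ⟨hz.1, (mem_Iic.1 hz.2).trans hxx₀⟩, fun hz => ⟨hz.1, hmax hz⟩⟩

/-- An open set of reals of measure more than `a` receives an expanding map from `[0, a]`. -/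
theorem exists_expanding_map_of_lt_volume {A : Set ℝ} (hA : IsOpen A) {a : ℝ} (ha : 0 ≤ a)
    (hvol : ENNReal.ofReal a < volume A) :
    ∃ g : ℝ → ℝ, (∀ t ∈ Icc 0 a, g t ∈ A) ∧
      ∀ s ∈ Icc 0 a, ∀ t ∈ Icc 0 a, s < t → t - s ≤ g t - g s := by
  obtain ⟨K, hKA, hK, hKvol⟩ := hA.exists_lt_isCompact hvol
  have hfin : ∀ x, volume (K ∩ Iic x) ≠ ⊤ := fun x =>
    measure_ne_top_of_subset inter_subset_left hK.measure_lt_top.ne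
  have haK : a < volume.real K :=
    (ENNReal.ofReal_lt_iff_lt_toReal ha hK.measure_lt_top.ne).1 hKvol
  have hex : ∀ t ∈ Icc 0 a, ∃ x ∈ K, volume.real (K ∩ Iic x) = t + (volume.real K - a) :=
    fun t ht => exists_mem_volume_inter_Iic_eq hK (by linarith [ht.1]) (by linarith [ht.2])
  choose! g hgK hg using hex
  refine ⟨g, fun t ht => hKA (hgK t ht), fun s hs t ht hst => ?_⟩
  rcases le_total (g s) (g t) with h | h
  · linarith [volume_real_inter_Iic_sub_le hK.measure_lt_top.ne h, hg s hs, hg t ht]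
  · have := measureReal_mono (μ := volume)
      (inter_subset_inter_right K (Iic_subset_Iic.2 h)) (hfin (g s))
    linarith [hg s hs, hg t ht]

/-- Fubini's theorem along the lines of slope `b`. -/
theorem volume_eq_lintegral_slope {S : Set (ℝ × ℝ)} (hS : MeasurableSet S) (b : ℝ) :
    volume S = ∫⁻ c, volume {x : ℝ | (x, c + b * x) ∈ S} := by
  have hmeas : Measurable fun p : ℝ × ℝ => (p.1, p.2 + b * p.1) := by fun_prop
  have hT := hmeas hS
  rw [Measure.volume_eq_prod, Measure.prod_apply hS]
  trans (volume.prod volume) ((fun p : ℝ × ℝ => (p.1, p.2 + b * p.1)) ⁻¹' S)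
  · rw [Measure.prod_apply hT]
    exact lintegral_congr fun x =>
      (measure_preimage_add_right volume (b * x) (Prod.mk x ⁻¹' S)).symm
  · rw [Measure.prod_apply_symm hT]
    rfl

/-- If a line of slope `b` meets an open set in a set whose horizontal projection is longer than
`a`, the open set contains the graph of every increasing function on `[0, a]` that grows at rate
at most `b`. -/
theorem pContains_graph_of_lt_volume_slope {a b c : ℝ} (ha : 0 ≤ a) (hb : 0 ≤ b) {f : ℝ → ℝ}
    (hmono : StrictMonoOn f (Icc 0 a))
    (hlip : ∀ s t : ℝ, s ∈ Icc (0 : ℝ) a → t ∈ Icc (0 : ℝ) a → s < t →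
      f t - f s ≤ b * (t - s))
    {S : Set (ℝ × ℝ)} (hS : IsOpen S)
    (hvol : ENNReal.ofReal a < volume {x : ℝ | (x, c + b * x) ∈ S}) :
    PContains S ((fun t : ℝ => (t, f t)) '' Icc (0 : ℝ) a) := by
  have hA : IsOpen {x : ℝ | (x, c + b * x) ∈ S} :=
    hS.preimage (f := fun x : ℝ => (x, c + b * x)) (by fun_prop)
  obtain ⟨g, hgA, hg⟩ := exists_expanding_map_of_lt_volume hA ha hvol
  have hinv : LeftInvOn (Function.invFunOn f (Icc 0 a)) f (Icc 0 a) :=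
    hmono.injOn.leftInvOn_invFunOn
  refine ⟨g, fun y => c + b * g (Function.invFunOn f (Icc 0 a) y), ?_, ?_, ?_⟩
  · rintro _ _ ⟨_, t, ht, heq⟩ ⟨_, s, hs, heq'⟩ hst
    obtain ⟨rfl, -⟩ := Prod.mk.inj heq
    obtain ⟨rfl, -⟩ := Prod.mk.inj heq'
    exact hg s hs t ht hst
  · rintro _ _ ⟨_, t, ht, heq⟩ ⟨_, s, hs, heq'⟩ hst
    obtain ⟨-, rfl⟩ := Prod.mk.inj heq
    obtain ⟨-, rfl⟩ := Prod.mk.inj heq'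
    have hlt : s < t := (hmono.lt_iff_lt hs ht).1 hst
    simp only [hinv ht, hinv hs]
    linarith [hlip s t hs ht hlt, mul_le_mul_of_nonneg_left (hg s hs t ht hlt) hb]
  · rintro _ ⟨t, ht, rfl⟩
    simp only [hinv ht]
    exact hgA t ht

/-- A vertical strip of width `a` contains no graph over `[0, a]`. -/
theorem not_pContains_strip {a n : ℝ} (ha : 0 < a) (f : ℝ → ℝ) :
    ¬ PContains (Ioo 0 a ×ˢ Ioo 0 n) ((fun t : ℝ => (t, f t)) '' Icc (0 : ℝ) a) := by
  rintro ⟨fX, fY, hX, -, hmem⟩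
  have h0 : (0 : ℝ) ∈ Icc 0 a := left_mem_Icc.2 ha.le
  have h1 : a ∈ Icc 0 a := right_mem_Icc.2 ha.le
  have h := hX a 0 ⟨f a, a, h1, rfl⟩ ⟨f 0, 0, h0, rfl⟩ ha
  have hl : 0 < fX 0 := (hmem _ ⟨0, h0, rfl⟩).1.1
  have hr : fX a < a := (hmem _ ⟨a, h1, rfl⟩).1.2
  linarith

theorem px_increasing_graph (a b : ℝ) (ha : 0 < a) (hb : 0 < b) (f : ℝ → ℝ)
    (hmono : StrictMonoOn f (Set.Icc 0 a))
    (hlip : ∀ s t : ℝ, s ∈ Set.Icc (0 : ℝ) a → t ∈ Set.Icc (0 : ℝ) a → s < t →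
      f t - f s ≤ b * (t - s)) :
    ∀ n : ℝ, max a (a * b) ≤ n →
      ENNReal.ofReal (a * n) ≤ px n ((fun t : ℝ => (t, f t)) '' Set.Icc (0 : ℝ) a) ∧
      px n ((fun t : ℝ => (t, f t)) '' Set.Icc (0 : ℝ) a) ≤
        ENNReal.ofReal ((a + a * b) * n) := by
  intro n hn
  have han : a ≤ n := (le_max_left _ _).trans hn
  constructor
  · refine le_sSup ⟨Ioo 0 a ×ˢ Ioo 0 n, isOpen_Ioo.prod isOpen_Ioo, ?_,
      not_pContains_strip ha f, ?_⟩
    · rintro ⟨x, y⟩ ⟨hx, hy⟩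
      exact ⟨⟨hx.1.le, hy.1.le⟩, ⟨hx.2.le.trans han, hy.2.le⟩⟩
    · rw [Measure.volume_eq_prod, Measure.prod_prod, Real.volume_Ioo, Real.volume_Ioo,
        sub_zero, sub_zero, ENNReal.ofReal_mul ha.le]
  · refine sSup_le ?_
    rintro _ ⟨S, hS, hSn, hfree, rfl⟩
    have hbound : ∀ c, volume {x : ℝ | (x, c + b * x) ∈ S} ≤
        (Icc (-(b * n)) n).indicator (fun _ => ENNReal.ofReal a) c := by
      intro c
      by_cases hc : c ∈ Icc (-(b * n)) n
      · rw [indicator_of_mem hc]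
        exact not_lt.1 fun h =>
          hfree (pContains_graph_of_lt_volume_slope ha.le hb.le hmono hlip hS h)
      · have : {x : ℝ | (x, c + b * x) ∈ S} = ∅ := by
          refine eq_empty_of_forall_notMem fun x hx => hc ?_
          obtain ⟨⟨hx0, hy0⟩, hxn, hyn⟩ := hSn hx
          simp only at hx0 hy0 hxn hyn
          constructor
          · linarith [mul_le_mul_of_nonneg_left hxn hb.le]
          · linarith [mul_nonneg hb.le hx0]
        simp [this]
    calc volume S = ∫⁻ c, volume {x : ℝ | (x, c + b * x) ∈ S} :=
          volume_eq_lintegral_slope hS.measurableSet b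
      _ ≤ ∫⁻ c, (Icc (-(b * n)) n).indicator (fun _ => ENNReal.ofReal a) c :=
          lintegral_mono hbound
      _ = ENNReal.ofReal ((a + a * b) * n) := by
          rw [lintegral_indicator_const measurableSet_Icc, Real.volume_Icc,
            ← ENNReal.ofReal_mul ha.le]
          congr 1
          ring
end

section
/- Fix an integer t ≥ 1 and reals c > 0 and n > 0. Let X ⊆ ℝ^t be the set of points (y₁, …, y_t) such that 0 < y_t < n − (t−1)c and, for every i = 1, …, t−1, y_{i+1} + c < y_i < n − (i−1)c. Then the t-dimensional Lebesgue measure of X satisfies μ_t(X) ≤ n^t, and if in addition n ≥ c·t then μ_t(X) ≥ (n/t − c)^t. -/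
open MeasureTheory Set
open scoped ENNReal

theorem volume_staircase_simplex (t : ℕ) (ht : 1 ≤ t) (c n : ℝ) (hc : 0 < c) (hn : 0 < n)
    (X : Set (Fin t → ℝ))
    (hX : X = {y : Fin t → ℝ |
      (0 < y ⟨t - 1, by omega⟩ ∧ y ⟨t - 1, by omega⟩ < n - ((t : ℝ) - 1) * c) ∧
      ∀ (i : ℕ) (hi : i + 1 < t),
        y ⟨i + 1, hi⟩ + c < y ⟨i, by omega⟩ ∧ y ⟨i, by omega⟩ < n - (i : ℝ) * c}) :
    volume X ≤ ENNReal.ofReal (n ^ t) ∧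
      (c * t ≤ n → ENNReal.ofReal ((n / t - c) ^ t) ≤ volume X) := by
  subst hX
  have ht0 : (0 : ℝ) < t := by exact_mod_cast ht
  constructor
  · have hbox : volume (univ.pi fun _ : Fin t => Ioo (0 : ℝ) n) = ENNReal.ofReal (n ^ t) := by
      simp [volume_pi_pi, ENNReal.ofReal_pow hn.le]
    rw [← hbox]
    refine measure_mono fun y hy => ?_
    obtain ⟨⟨hpos, hlast⟩, hstep⟩ := hy
    have hy_pos : ∀ (k i : ℕ) (hi : i < t), i + k = t - 1 → 0 < y ⟨i, hi⟩ := by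
      intro k
      induction k with
      | zero =>
        intro i hi hik
        obtain rfl : i = t - 1 := by omega
        exact hpos
      | succ k ih =>
        intro i hi hik
        have h₁ := ih (i + 1) (by omega) (by omega)
        have h₂ := (hstep i (by omega)).1
        linarith
    rintro ⟨i, hi⟩ -
    refine ⟨hy_pos (t - 1 - i) i hi (by omega), ?_⟩
    rcases Nat.lt_or_ge (i + 1) t with h | h
    · have h₁ := (hstep i h).2
      have h₂ : 0 ≤ (i : ℝ) * c := by positivity
      linarith
    · obtain rfl : i = t - 1 := by omega
      have h₁ : (1 : ℝ) ≤ t := by exact_mod_cast ht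
      have h₂ : 0 ≤ ((t : ℝ) - 1) * c := mul_nonneg (by linarith) hc.le
      linarith
  · intro hct
    have hcw : c ≤ n / t := (le_div_iff₀ ht0).2 hct
    set d : ℝ := n / t with hd
    have hnd : n = t * d := by rw [hd]; field_simp
    have hbox : volume (univ.pi fun i : Fin t =>
        Ioo (((t : ℝ) - 1 - (i : ℕ)) * d) (((t : ℝ) - (i : ℕ)) * d - c)) =
          ENNReal.ofReal ((d - c) ^ t) := by
      have hwidth : ∀ i : Fin t,
          ((t : ℝ) - (i : ℕ)) * d - c - ((t : ℝ) - 1 - (i : ℕ)) * d = d - c := fun i => by ring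
      simp [volume_pi_pi, hwidth, ENNReal.ofReal_pow (sub_nonneg.2 hcw)]
    rw [← hbox]
    refine measure_mono fun y hy => ?_
    have hupper : ∀ i : Fin t, y i < n - (i : ℕ) * c := by
      intro i
      have h₁ := (hy i (mem_univ i)).2
      have h₂ : ((i : ℕ) : ℝ) * c ≤ (i : ℕ) * d :=
        mul_le_mul_of_nonneg_left hcw (Nat.cast_nonneg _)
      linarith
    refine ⟨⟨?_, ?_⟩, fun i hi => ⟨?_, hupper ⟨i, by omega⟩⟩⟩
    · have h := (hy ⟨t - 1, by omega⟩ (mem_univ _)).1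
      simpa [Nat.cast_sub ht] using h
    · have h := hupper ⟨t - 1, by omega⟩
      simpa [Nat.cast_sub ht] using h
    · have h₁ := (hy ⟨i + 1, hi⟩ (mem_univ _)).2
      have h₂ := (hy ⟨i, by omega⟩ (mem_univ _)).1
      push_cast at h₁ h₂
      linarith
end

section
/- Fix an integer t ≥ 2 and reals c > 0 and s > 0, and let P_{s,t,c} = [0, s] × {c, 2c, …, tc} ⊆ ℝ² (t horizontal segments of length s stacked vertically with consecutive segments a distance c apart). Then for every real n > 0, px(n, P_{s,t,c}) ≤ c·t·n + t·s^{1/t}·n^{2 − 1/t}. -/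
open MeasureTheory Set
open scoped ENNReal

/-- The measure of the part of `A` to the left of `y`. -/
noncomputable def leftMass (A : Set ℝ) (y : ℝ) : ℝ := volume.real (A ∩ Iic y)

lemma leftMass_add {A : Set ℝ} (hA : MeasurableSet A) (hfin : volume A ≠ ∞) {a b : ℝ}
    (hab : a ≤ b) : leftMass A b = leftMass A a + volume.real (A ∩ Ioc a b) := by
  have hu : A ∩ Iic b = (A ∩ Iic a) ∪ (A ∩ Ioc a b) := by
    rw [← inter_union_distrib_left, Iic_union_Ioc_eq_Iic hab]
  have hd : Disjoint (A ∩ Iic a) (A ∩ Ioc a b) := by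
    rw [Set.disjoint_left]
    rintro x ⟨-, h1⟩ ⟨-, h2⟩
    exact absurd h2.1 (not_lt.mpr h1)
  unfold leftMass
  rw [hu]
  exact measureReal_union hd (hA.inter measurableSet_Ioc)
    (measure_ne_top_of_subset inter_subset_left hfin)
    (measure_ne_top_of_subset inter_subset_left hfin)

lemma leftMass_sub_le {A : Set ℝ} (hA : MeasurableSet A) (hfin : volume A ≠ ∞) {a b : ℝ}
    (hab : a ≤ b) : leftMass A b - leftMass A a ≤ b - a := by
  have h1 : volume.real (A ∩ Ioc a b) ≤ volume.real (Ioc a b) :=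
    measureReal_mono inter_subset_right (by simp)
  rw [Real.volume_real_Ioc_of_le hab] at h1
  linarith [leftMass_add hA hfin hab]

lemma leftMass_mono {A : Set ℝ} (hA : MeasurableSet A) (hfin : volume A ≠ ∞) :
    Monotone (leftMass A) := fun a b hab => by
  rw [leftMass_add hA hfin hab]
  exact le_add_of_nonneg_right measureReal_nonneg

lemma sub_le_sub_of_leftMass {A : Set ℝ} (hA : MeasurableSet A) (hfin : volume A ≠ ∞) {a b d : ℝ}
    (hd : 0 < d) (h : d ≤ leftMass A b - leftMass A a) : d ≤ b - a := by
  rcases le_total a b with hab | hab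
  · exact h.trans (leftMass_sub_le hA hfin hab)
  · linarith [leftMass_mono hA hfin hab]

lemma continuous_leftMass {A : Set ℝ} (hA : MeasurableSet A) (hfin : volume A ≠ ∞) :
    Continuous (leftMass A) := by
  refine (LipschitzWith.of_le_add fun x y => ?_).continuous
  rcases le_total x y with h | h
  · linarith [leftMass_mono hA hfin h, dist_nonneg (x := x) (y := y)]
  · rw [Real.dist_eq, abs_of_nonneg (sub_nonneg.mpr h)]
    linarith [leftMass_sub_le hA hfin h]

lemma exists_leftMass_eq {A : Set ℝ} (hA : MeasurableSet A) {n : ℝ} (hn : 0 ≤ n)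
    (hAn : A ⊆ Icc 0 n) {v : ℝ} (hv : v ∈ Icc 0 (volume.real A)) : ∃ y, leftMass A y = v := by
  have hfin : volume A ≠ ∞ := measure_ne_top_of_subset hAn (by simp)
  have h0 : leftMass A 0 = 0 := by
    have hsub : A ∩ Iic 0 ⊆ {0} := fun x hx => le_antisymm hx.2 (hAn hx.1).1
    have : volume (A ∩ Iic 0) = 0 := measure_mono_null hsub (by simp)
    simp [leftMass, Measure.real, this]
  have h1 : leftMass A n = volume.real A := by
    rw [leftMass, inter_eq_left.mpr (hAn.trans Icc_subset_Iic_self)]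
  obtain ⟨y, -, hy⟩ := intermediate_value_Icc hn (continuous_leftMass hA hfin).continuousOn
    (by rwa [h0, h1])
  exact ⟨y, hy⟩

lemma exists_mem_leftMass_eq {K : Set ℝ} (hK : IsCompact K) {n : ℝ} (hn : 0 ≤ n)
    (hKn : K ⊆ Icc 0 n) {v : ℝ} (hv0 : 0 < v) (hv : v ≤ volume.real K) :
    ∃ a ∈ K, leftMass K a = v := by
  have hm : MeasurableSet K := hK.measurableSet
  have hfin : volume K ≠ ∞ := hK.measure_lt_top.ne
  obtain ⟨b, hb⟩ := exists_leftMass_eq hm hn hKn ⟨hv0.le, hv⟩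
  have hne : (K ∩ Iic b).Nonempty := by
    by_contra h
    rw [not_nonempty_iff_eq_empty] at h
    rw [leftMass, h, measureReal_empty] at hb
    exact hv0.ne hb
  obtain ⟨a, ha, hmax⟩ := (hK.inter_right isClosed_Iic).exists_isGreatest hne
  refine ⟨a, ha.1, ?_⟩
  have he : K ∩ Ioc a b = ∅ := by
    rw [eq_empty_iff_forall_notMem]
    rintro x ⟨hx, hx'⟩
    exact absurd (hmax ⟨hx, hx'.2⟩) (not_le.mpr hx'.1)
  have := leftMass_add hm hfin ha.2
  rw [he, measureReal_empty] at this
  linarith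

/-- A bounded measurable set of measure greater than `s` contains an expanding copy of `[0, s]`. -/
lemma exists_expanding_map_s17 {A : Set ℝ} (hA : MeasurableSet A) {n s : ℝ} (hn : 0 ≤ n)
    (hs : 0 ≤ s) (hAn : A ⊆ Icc 0 n) (h : ENNReal.ofReal s < volume A) :
    ∃ f : ℝ → ℝ, (∀ x ∈ Icc 0 s, f x ∈ A) ∧
      ∀ x₀ ∈ Icc 0 s, ∀ x₁ ∈ Icc 0 s, x₁ < x₀ → x₀ - x₁ ≤ f x₀ - f x₁ := by
  obtain ⟨K, hKA, hK, hKs⟩ := hA.exists_lt_isCompact h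
  have hfin : volume K ≠ ∞ := hK.measure_lt_top.ne
  have hs' : s < volume.real K := (ENNReal.ofReal_lt_iff_lt_toReal hs hfin).mp hKs
  have hex : ∀ x : ℝ, ∃ a, x ∈ Icc 0 s → a ∈ K ∧ leftMass K a = x + (volume.real K - s) := by
    intro x
    by_cases hx : x ∈ Icc 0 s
    · obtain ⟨a, ha, hax⟩ := exists_mem_leftMass_eq hK hn (hKA.trans hAn)
        (v := x + (volume.real K - s)) (by linarith [hx.1]) (by linarith [hx.2])
      exact ⟨a, fun _ => ⟨ha, hax⟩⟩
    · exact ⟨0, fun h => absurd h hx⟩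
  choose f hf using hex
  refine ⟨f, fun x hx => hKA (hf x hx).1, fun x₀ h₀ x₁ h₁ hlt => ?_⟩
  refine sub_le_sub_of_leftMass hK.measurableSet hfin (sub_pos.mpr hlt) ?_
  rw [(hf x₀ h₀).2, (hf x₁ h₁).2]
  linarith

/-- The increasing `t`-tuples whose consecutive terms are at least `c` apart. -/
def separatedTuples (t : ℕ) (c : ℝ) : Set (Fin t → ℝ) :=
  {y | ∀ j k : Fin t, j < k → ((k : ℝ) - j) * c ≤ y k - y j}

lemma measurableSet_separatedTuples (t : ℕ) (c : ℝ) : MeasurableSet (separatedTuples t c) := by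
  simp only [separatedTuples, ofPred_forall]
  refine MeasurableSet.iInter fun j => .iInter fun k => .iInter fun _ => ?_
  exact measurableSet_le measurable_const ((measurable_pi_apply k).sub (measurable_pi_apply j))

lemma volume_separatedTuples_ge {t : ℕ} (ht : 0 < t) {c : ℝ} (hc : 0 < c) {A : Set ℝ}
    (hA : MeasurableSet A) {n : ℝ} (hn : 0 ≤ n) (hAn : A ⊆ Icc 0 n) :
    (volume A / t - ENNReal.ofReal c) ^ t ≤
      volume (separatedTuples t c ∩ {y | ∀ j, y j ∈ A}) := by
  have hfin : volume A ≠ ∞ := measure_ne_top_of_subset hAn (by simp)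
  have ht' : (0 : ℝ) < t := by exact_mod_cast ht
  set r : ℝ := volume.real A / t - c with hr
  have hrE : volume A / t - ENNReal.ofReal c = ENNReal.ofReal r := by
    rw [hr, ENNReal.ofReal_sub _ hc.le, ENNReal.ofReal_div_of_pos ht', ofReal_measureReal hfin,
      ENNReal.ofReal_natCast]
  rw [hrE]
  rcases le_or_gt r 0 with hr0 | hr0
  · simp [ENNReal.ofReal_of_nonpos hr0, ht.ne']
  have hm : volume.real A = t * (c + r) := by
    rw [hr]; field_simp; ring
  have hj : ∀ j : Fin t, ((j : ℕ) : ℝ) + 1 ≤ t := fun j => by exact_mod_cast j.2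
  have hlow : ∀ j : Fin t, ∃ a, leftMass A a = j * (c + r) := fun j =>
    exists_leftMass_eq hA hn hAn ⟨by positivity, by rw [hm]; nlinarith [hj j]⟩
  have hupp : ∀ j : Fin t, ∃ b, leftMass A b = j * (c + r) + r := fun j =>
    exists_leftMass_eq hA hn hAn ⟨by positivity, by rw [hm]; nlinarith [hj j]⟩
  choose a ha using hlow
  choose b hb using hupp
  have hab : ∀ j, a j ≤ b j := fun j => by
    have := sub_le_sub_of_leftMass hA hfin (a := a j) (b := b j) hr0 (by rw [ha, hb]; linarith)
    linarith
  have hvol : ∀ j, volume (A ∩ Ioc (a j) (b j)) = ENNReal.ofReal r := fun j => by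
    rw [← ofReal_measureReal (measure_ne_top_of_subset inter_subset_left hfin)]
    congr 1
    linarith [leftMass_add hA hfin (hab j), ha j, hb j]
  calc ENNReal.ofReal r ^ t = volume (Set.pi univ fun j => A ∩ Ioc (a j) (b j)) := by
        rw [volume_pi_pi]; simp [hvol]
    _ ≤ _ := by
        refine measure_mono fun y hy => ⟨fun j k hjk => ?_, fun j => (hy j trivial).1⟩
        have hjk' : ((j : ℕ) : ℝ) + 1 ≤ (k : ℕ) := by exact_mod_cast hjk
        refine sub_le_sub_of_leftMass hA hfin (mul_pos (by linarith) hc) ?_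
        have h1 := leftMass_mono hA hfin (hy j trivial).2.2
        have h2 := leftMass_mono hA hfin (hy k trivial).2.1.le
        rw [hb] at h1
        rw [ha] at h2
        nlinarith

lemma volume_common_section_le {t : ℕ} {c s n : ℝ} (hc : 0 < c) (hs : 0 ≤ s) (hn : 0 ≤ n)
    {S : Set (ℝ × ℝ)} (hS : IsOpen S) (hSn : S ⊆ Icc (0, 0) (n, n)) (ht : 0 < t)
    (hfree : ¬ PContains S (Icc (0 : ℝ) s ×ˢ {y : ℝ | ∃ j : Fin t, y = ((j : ℕ) + 1) * c}))
    {y : Fin t → ℝ} (hy : y ∈ separatedTuples t c) :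
    volume {x | ∀ j, (x, y j) ∈ S} ≤ ENNReal.ofReal s := by
  by_contra! hlt
  apply hfree
  have hm : MeasurableSet {x | ∀ j, (x, y j) ∈ S} := by
    rw [ofPred_forall]
    exact .iInter fun j => (measurable_id.prodMk measurable_const) hS.measurableSet
  have hsub : {x | ∀ j, (x, y j) ∈ S} ⊆ Icc 0 n := fun x hx =>
    ⟨(hSn (hx ⟨0, ht⟩)).1.1, (hSn (hx ⟨0, ht⟩)).2.1⟩
  obtain ⟨f, hfA, hf⟩ := exists_expanding_map_s17 hm hn hs hsub hlt
  have hex : ∀ z : ℝ, ∃ w, ∀ j : Fin t, z = ((j : ℕ) + 1) * c → w = y j := by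
    intro z
    by_cases h : ∃ j : Fin t, z = ((j : ℕ) + 1) * c
    · obtain ⟨j, rfl⟩ := h
      refine ⟨y j, fun k hk => ?_⟩
      have h1 := mul_right_cancel₀ hc.ne' hk
      have h2 : (j : ℕ) = k := by exact_mod_cast add_right_cancel h1
      rw [Fin.ext h2]
    · exact ⟨0, fun j hj => absurd ⟨j, hj⟩ h⟩
  choose g hg using hex
  refine ⟨f, g, ?_, ?_, ?_⟩
  · rintro x₀ x₁ ⟨_, h₀⟩ ⟨_, h₁⟩ hlt
    exact hf x₀ h₀.1 x₁ h₁.1 hlt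
  · rintro y₀ y₁ ⟨_, -, k, hk⟩ ⟨_, -, j, hj⟩ hlt
    simp only at hk hj
    rw [hg y₀ k hk, hg y₁ j hj]
    have hjk : j < k := by
      rw [hk, hj] at hlt
      have h1 := lt_of_mul_lt_mul_right hlt hc.le
      have h2 : ((j : ℕ) : ℝ) < (k : ℕ) := by linarith
      exact_mod_cast h2
    refine le_trans (le_of_eq ?_) (hy j k hjk)
    rw [hk, hj]; ring
  · rintro ⟨x, z⟩ ⟨hx, j, hj⟩
    simp only at hx hj ⊢
    rw [hg z j hj]
    exact hfA x hx j

lemma lintegral_section_excess_pow_le {t : ℕ} {c s n : ℝ} (hc : 0 < c) (hs : 0 ≤ s) (hn : 0 ≤ n)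
    {S : Set (ℝ × ℝ)} (hS : IsOpen S) (hSn : S ⊆ Icc (0, 0) (n, n)) (ht : 0 < t)
    (hfree : ¬ PContains S (Icc (0 : ℝ) s ×ˢ {y : ℝ | ∃ j : Fin t, y = ((j : ℕ) + 1) * c})) :
    ∫⁻ x, (volume (Prod.mk x ⁻¹' S) / t - ENNReal.ofReal c) ^ t ≤
      ENNReal.ofReal s * ENNReal.ofReal n ^ t := by
  set T : Set (ℝ × (Fin t → ℝ)) := {p | p.2 ∈ separatedTuples t c ∧ ∀ j, (p.1, p.2 j) ∈ S}
  have hT : MeasurableSet T := by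
    have hcommon : MeasurableSet {p : ℝ × (Fin t → ℝ) | ∀ j, (p.1, p.2 j) ∈ S} := by
      rw [ofPred_forall]
      exact .iInter fun j => (measurable_fst.prodMk
        ((measurable_pi_apply j).comp measurable_snd)) hS.measurableSet
    exact (measurable_snd (measurableSet_separatedTuples t c)).inter hcommon
  calc ∫⁻ x, (volume (Prod.mk x ⁻¹' S) / t - ENNReal.ofReal c) ^ t
      ≤ ∫⁻ x, volume (Prod.mk x ⁻¹' T) := lintegral_mono fun x =>
        volume_separatedTuples_ge ht hc (measurable_prodMk_left hS.measurableSet) hn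
          fun y hy => ⟨(hSn hy).1.2, (hSn hy).2.2⟩
    _ = ∫⁻ y, volume ((fun x => (x, y)) ⁻¹' T) := by
        rw [← Measure.prod_apply hT, ← Measure.prod_apply_symm hT]
    _ ≤ ∫⁻ y, (Set.pi univ fun _ : Fin t => Icc 0 n).indicator
          (fun _ => ENNReal.ofReal s) y := by
        refine lintegral_mono fun y => ?_
        by_cases hne : ((fun x => (x, y)) ⁻¹' T).Nonempty
        · obtain ⟨x, hx⟩ := hne
          rw [indicator_of_mem fun j _ => ⟨(hSn (hx.2 j)).1.2, (hSn (hx.2 j)).2.2⟩]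
          exact (measure_mono fun x hx => hx.2).trans
            (volume_common_section_le hc hs hn hS hSn ht hfree hx.1)
        · rw [not_nonempty_iff_eq_empty.mp hne, measure_empty]
          exact zero_le
    _ = ENNReal.ofReal s * ENNReal.ofReal n ^ t := by
        rw [lintegral_indicator_const (MeasurableSet.univ_pi fun _ => measurableSet_Icc),
          volume_pi_pi]
        simp

lemma lintegral_le_of_lintegral_pow_le {α : Type*} [MeasurableSpace α] {μ : Measure α} {t : ℕ}
    (ht : 2 ≤ t) {f : α → ℝ≥0∞} (hf : Measurable f) {B : ℝ≥0∞} (h : ∫⁻ x, f x ^ t ∂μ ≤ B) :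
    ∫⁻ x, f x ∂μ ≤ B ^ (1 / (t : ℝ)) * μ univ ^ (1 - 1 / (t : ℝ)) := by
  have ht1 : (1 : ℝ) < t := by exact_mod_cast ht
  have hpq := Real.HolderConjugate.conjExponent ht1
  have hH := ENNReal.lintegral_mul_le_Lp_mul_Lq μ hpq hf.aemeasurable
    (aemeasurable_const (b := (1 : ℝ≥0∞)))
  have hq : 1 / Real.conjExponent (t : ℝ) = 1 - 1 / (t : ℝ) := by
    rw [one_div, one_div, hpq.one_sub_inv]
  simp only [Pi.mul_apply, mul_one, ENNReal.one_rpow, lintegral_one, hq,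
    ENNReal.rpow_natCast] at hH
  exact hH.trans (by gcongr)

lemma volume_le_of_not_pContains {t : ℕ} (ht : 2 ≤ t) {c s n : ℝ} (hc : 0 < c) (hs : 0 < s)
    (hn : 0 < n) {S : Set (ℝ × ℝ)} (hS : IsOpen S) (hSn : S ⊆ Icc (0, 0) (n, n))
    (hfree : ¬ PContains S (Icc (0 : ℝ) s ×ˢ {y : ℝ | ∃ j : Fin t, y = ((j : ℕ) + 1) * c})) :
    volume S ≤ ENNReal.ofReal (c * t * n + t * s ^ (1 / (t : ℝ)) * n ^ (2 - 1 / (t : ℝ))) := by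
  have ht0 : 0 < t := by omega
  have ht0' : (t : ℝ) ≠ 0 := by positivity
  set m : ℝ → ℝ≥0∞ := fun x => volume (Prod.mk x ⁻¹' S) with hm
  have hmm : Measurable m := measurable_measure_prodMk_left hS.measurableSet
  set r : ℝ → ℝ≥0∞ := fun x => m x / t - ENNReal.ofReal c with hr
  have hrm : Measurable r := (hmm.div_const _).sub measurable_const
  have hpow : ∫⁻ x in Icc 0 n, r x ^ t ≤ ENNReal.ofReal s * ENNReal.ofReal n ^ t :=
    (setLIntegral_le_lintegral _ _).trans
      (lintegral_section_excess_pow_le hc hs.le hn.le hS hSn ht0 hfree)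
  have hrI := lintegral_le_of_lintegral_pow_le ht hrm hpow
  have hbound : (ENNReal.ofReal s * ENNReal.ofReal n ^ t) ^ (1 / (t : ℝ)) *
      (volume.restrict (Icc 0 n)) univ ^ (1 - 1 / (t : ℝ)) =
      ENNReal.ofReal (s ^ (1 / (t : ℝ)) * n ^ (2 - 1 / (t : ℝ))) := by
    have he : (2 : ℝ) - 1 / t = 1 + (1 - 1 / t) := by ring
    have h1 : (0 : ℝ) ≤ 1 - 1 / t := by
      rw [sub_nonneg, div_le_one (by positivity)]
      exact_mod_cast ht0
    rw [Measure.restrict_apply_univ, Real.volume_Icc, sub_zero,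
      ENNReal.mul_rpow_of_nonneg _ _ (by positivity), ← ENNReal.rpow_natCast, ← ENNReal.rpow_mul,
      mul_one_div_cancel ht0', ENNReal.rpow_one, ENNReal.ofReal_rpow_of_pos hs,
      ENNReal.ofReal_rpow_of_pos hn, he, Real.rpow_add hn, Real.rpow_one,
      ENNReal.ofReal_mul (by positivity), ENNReal.ofReal_mul hn.le, mul_assoc]
  rw [hbound] at hrI
  have hsupp : ∀ x, m x ≤ (Icc 0 n).indicator (fun x => t * (ENNReal.ofReal c + r x)) x := by
    intro x
    by_cases hx : x ∈ Icc 0 n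
    · rw [indicator_of_mem hx]
      calc m x = t * (m x / t) := by
            rw [ENNReal.mul_div_cancel (by exact_mod_cast ht0.ne') (ENNReal.natCast_ne_top t)]
        _ ≤ _ := by gcongr; exact le_add_tsub
    · have : Prod.mk x ⁻¹' S = ∅ := by
        rw [eq_empty_iff_forall_notMem]
        exact fun y hy => hx ⟨(hSn hy).1.1, (hSn hy).2.1⟩
      simp [hm, this]
  calc volume S = ∫⁻ x, m x := Measure.prod_apply hS.measurableSet
    _ ≤ ∫⁻ x in Icc 0 n, t * (ENNReal.ofReal c + r x) := by
        rw [← lintegral_indicator measurableSet_Icc]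
        exact lintegral_mono hsupp
    _ = t * (ENNReal.ofReal c * ENNReal.ofReal n + ∫⁻ x in Icc 0 n, r x) := by
        rw [lintegral_const_mul _ (hrm.const_add _),
          lintegral_add_left measurable_const]
        simp
    _ ≤ t * (ENNReal.ofReal c * ENNReal.ofReal n +
          ENNReal.ofReal (s ^ (1 / (t : ℝ)) * n ^ (2 - 1 / (t : ℝ)))) := by gcongr
    _ = _ := by
        rw [← ENNReal.ofReal_mul hc.le, ← ENNReal.ofReal_add (by positivity) (by positivity),
          ← ENNReal.ofReal_natCast, ← ENNReal.ofReal_mul (by positivity)]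
        congr 1
        ring

theorem px_stacked_segments_kst (t : ℕ) (ht : 2 ≤ t) (c s : ℝ) (hc : 0 < c) (hs : 0 < s) :
    ∀ n : ℝ, 0 < n →
      px n (Set.Icc (0 : ℝ) s ×ˢ {y : ℝ | ∃ j : Fin t, y = ((j : ℕ) + 1) * c}) ≤
        ENNReal.ofReal (c * t * n + t * s ^ (1 / (t : ℝ)) * n ^ (2 - 1 / (t : ℝ))) := by
  intro n hn
  refine sSup_le ?_
  rintro m ⟨S, hS, hSn, hfree, rfl⟩
  exact volume_le_of_not_pContains ht hc hs hn hS hSn hfree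
end
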